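/- arXiv:0709.0145 — 5 statements merged into one kernel-verified Lean document; each statement's English description precedes it below -/
import Mathlib

section
/- For an observation system on a bipartite graph G=(V,F,E), the conditional entropy H(X | Y, Z(θ)) is differentiable in θ and satisfies the identity d/dθ H(X | Y, Z(θ)) = − Σ_{i∈V} H(X_i | Y, Z^{(i)}(θ)), where Z^{(U)}(θ) denotes the observation vector obtained from Z(θ) by replacing Z_i(θ) with (Z_i, ∗) for every i ∈ U. -/
open Finset MeasureTheory Filter

namespace PaperObs

/-- Reveal-perturbation factor for the perturbed observation `Z_i(θ)`:
`Z_i(θ) = (Z_i, X_i)` with probability `θ` and `(Z_i, ∗)` with probability `1-θ`,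
where `∗` is encoded by `Option.none`. -/
def pert {𝒳 : Type*} [DecidableEq 𝒳] (θ : ℝ) (o : Option 𝒳) (x : 𝒳) : ℝ :=
  if o = some x then θ else if o = none then 1 - θ else 0

section Core

variable {V F 𝒳 𝒴 𝒵 : Type*} [Fintype V] [Fintype F] [Fintype 𝒳] [Fintype 𝒴] [Fintype 𝒵]
  [DecidableEq V] [DecidableEq F] [DecidableEq 𝒳] [DecidableEq 𝒴]

/-- Joint density of `(X, Y_{S_F}, Z_{S_V}(θ))` in an observation system, where only the
observations `Y_a`, `a ∈ SF`, and `Z_i(θᵥ i)`, `i ∈ SV`, are kept (the others being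
marginalized out), and where the perturbation parameter is allowed to depend on the node. -/
def jointSub (p : 𝒳 → ℝ) (Q : F → 𝒴 → (V → 𝒳) → ℝ) (R : 𝒵 → 𝒳 → ℝ) (θv : V → ℝ)
    (SF : Finset F) (SV : Finset V)
    (x : V → 𝒳) (y : F → 𝒴) (z : V → 𝒵 × Option 𝒳) : ℝ :=
  (∏ i, p (x i)) * (∏ a ∈ SF, Q a (y a) x) *
    ∏ i ∈ SV, (R (z i).1 (x i) * pert (θv i) (z i).2 (x i))

/-- Conditional probability `P{X_{i(1)} = ξ₁, …, X_{i(k)} = ξ_k | Y_{SF}, Z_{SV}(θ)}`. -/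
noncomputable def condPTuple (p : 𝒳 → ℝ) (Q : F → 𝒴 → (V → 𝒳) → ℝ) (R : 𝒵 → 𝒳 → ℝ)
    (θv : V → ℝ) (SF : Finset F) (SV : Finset V) {k : ℕ} (ii : Fin k → V) (ξ : Fin k → 𝒳)
    (y : F → 𝒴) (z : V → 𝒵 × Option 𝒳) : ℝ :=
  (∑ x : V → 𝒳, if ∀ l, x (ii l) = ξ l then jointSub p Q R θv SF SV x y z else 0) /
    ∑ x : V → 𝒳, jointSub p Q R θv SF SV x y z

/-- Conditional probability `P{X_U = ξ_U | Y_{SF}, Z_{SV}(θ)}` for a set `U` of variable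
nodes. -/
noncomputable def condPOn (p : 𝒳 → ℝ) (Q : F → 𝒴 → (V → 𝒳) → ℝ) (R : 𝒵 → 𝒳 → ℝ)
    (θv : V → ℝ) (SF : Finset F) (SV : Finset V) (U : Finset V) (ξ : {v // v ∈ U} → 𝒳)
    (y : F → 𝒴) (z : V → 𝒵 × Option 𝒳) : ℝ :=
  (∑ x : V → 𝒳, if ∀ l : {v // v ∈ U}, x l.1 = ξ l then jointSub p Q R θv SF SV x y z else 0) /
    ∑ x : V → 𝒳, jointSub p Q R θv SF SV x y z

/-- One-variable conditional marginal `P{X_i = ξ | Y_{SF}, Z_{SV}(θ)}`. -/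
noncomputable def margP (p : 𝒳 → ℝ) (Q : F → 𝒴 → (V → 𝒳) → ℝ) (R : 𝒵 → 𝒳 → ℝ)
    (θv : V → ℝ) (SF : Finset F) (SV : Finset V) (i : V) (ξ : 𝒳)
    (y : F → 𝒴) (z : V → 𝒵 × Option 𝒳) : ℝ :=
  condPTuple p Q R θv SF SV (fun _ : Fin 1 => i) (fun _ => ξ) y z

/-- Total variation distance between the joint conditional law of
`(X_{i(1)}, …, X_{i(k)})` given the observations and the product of its marginals. -/
noncomputable def tvTuple (p : 𝒳 → ℝ) (Q : F → 𝒴 → (V → 𝒳) → ℝ) (R : 𝒵 → 𝒳 → ℝ)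
    (θv : V → ℝ) (SF : Finset F) (SV : Finset V) {k : ℕ} (ii : Fin k → V)
    (y : F → 𝒴) (z : V → 𝒵 × Option 𝒳) : ℝ :=
  2⁻¹ * ∑ ξ : Fin k → 𝒳,
    |condPTuple p Q R θv SF SV ii ξ y z - ∏ l, margP p Q R θv SF SV (ii l) (ξ l) y z|

/-- Total variation distance between the joint conditional law of `X_U` given the
observations and the product of its marginals. -/
noncomputable def tvOn (p : 𝒳 → ℝ) (Q : F → 𝒴 → (V → 𝒳) → ℝ) (R : 𝒵 → 𝒳 → ℝ)
    (θv : V → ℝ) (SF : Finset F) (SV : Finset V) (U : Finset V)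
    (y : F → 𝒴) (z : V → 𝒵 × Option 𝒳) : ℝ :=
  2⁻¹ * ∑ ξ : {v // v ∈ U} → 𝒳,
    |condPOn p Q R θv SF SV U ξ y z - ∏ l : {v // v ∈ U}, margP p Q R θv SF SV l.1 (ξ l) y z|

/-- Expectation, over the observations `(Y, Z(θ))`, of a function `f` of the observations. -/
noncomputable def expObs (p : 𝒳 → ℝ) (Q : F → 𝒴 → (V → 𝒳) → ℝ) (R : 𝒵 → 𝒳 → ℝ)
    (θv : V → ℝ) (f : (F → 𝒴) → (V → 𝒵 × Option 𝒳) → ℝ) : ℝ :=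
  ∑ y : F → 𝒴, ∑ z : V → 𝒵 × Option 𝒳,
    (∑ x : V → 𝒳, jointSub p Q R θv univ univ x y z) * f y z

/-- Shannon entropy `H(X₁)` of a single variable with law `p`. -/
noncomputable def Hp (p : 𝒳 → ℝ) : ℝ := ∑ x, Real.negMulLog (p x)

/-- Conditional Shannon entropy `H(X | Y, Z(θ))` of the full hidden vector given
the observations, computed as `H(X, (Y,Z(θ))) - H(Y, Z(θ))`. -/
noncomputable def condEnt (p : 𝒳 → ℝ) (Q : F → 𝒴 → (V → 𝒳) → ℝ) (R : 𝒵 → 𝒳 → ℝ)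
    (θv : V → ℝ) : ℝ :=
  (∑ x : V → 𝒳, ∑ y : F → 𝒴, ∑ z : V → 𝒵 × Option 𝒳,
      Real.negMulLog (jointSub p Q R θv univ univ x y z)) -
    ∑ y : F → 𝒴, ∑ z : V → 𝒵 × Option 𝒳,
      Real.negMulLog (∑ x : V → 𝒳, jointSub p Q R θv univ univ x y z)

/-- Conditional Shannon entropy `H(X_i | Y, Z(θ))` of a single variable given the
observations. -/
noncomputable def condEnt1 (p : 𝒳 → ℝ) (Q : F → 𝒴 → (V → 𝒳) → ℝ) (R : 𝒵 → 𝒳 → ℝ)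
    (θv : V → ℝ) (i : V) : ℝ :=
  (∑ ξ : 𝒳, ∑ y : F → 𝒴, ∑ z : V → 𝒵 × Option 𝒳,
      Real.negMulLog (∑ x : V → 𝒳, if x i = ξ then jointSub p Q R θv univ univ x y z else 0)) -
    ∑ y : F → 𝒴, ∑ z : V → 𝒵 × Option 𝒳,
      Real.negMulLog (∑ x : V → 𝒳, jointSub p Q R θv univ univ x y z)

/-- Conditional mutual information `I(X_i ; X_j | Y, Z(θ))`. -/
noncomputable def condMI (p : 𝒳 → ℝ) (Q : F → 𝒴 → (V → 𝒳) → ℝ) (R : 𝒵 → 𝒳 → ℝ)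
    (θv : V → ℝ) (i j : V) : ℝ :=
  ∑ y : F → 𝒴, ∑ z : V → 𝒵 × Option 𝒳, ∑ ξ₁ : 𝒳, ∑ ξ₂ : 𝒳,
    (∑ x : V → 𝒳, if x i = ξ₁ ∧ x j = ξ₂ then jointSub p Q R θv univ univ x y z else 0) *
      Real.log
        (((∑ x : V → 𝒳, if x i = ξ₁ ∧ x j = ξ₂ then jointSub p Q R θv univ univ x y z else 0) *
            ∑ x : V → 𝒳, jointSub p Q R θv univ univ x y z) /
          ((∑ x : V → 𝒳, if x i = ξ₁ then jointSub p Q R θv univ univ x y z else 0) *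
            ∑ x : V → 𝒳, if x j = ξ₂ then jointSub p Q R θv univ univ x y z else 0))

/-- `p` is a probability distribution on the finite alphabet `𝒳`. -/
def IsPdist (p : 𝒳 → ℝ) : Prop := (∀ x, 0 ≤ p x) ∧ ∑ x, p x = 1

/-- The function-node observation kernels are genuine probability kernels. -/
def IsKernelQ (Q : F → 𝒴 → (V → 𝒳) → ℝ) : Prop :=
  (∀ a y x, 0 ≤ Q a y x) ∧ ∀ a x, ∑ y, Q a y x = 1

/-- The single-variable observation kernel is a genuine probability kernel. -/
def IsKernelR (R : 𝒵 → 𝒳 → ℝ) : Prop :=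
  (∀ z x, 0 ≤ R z x) ∧ ∀ x, ∑ z, R z x = 1

/-- Neighborhood `∂a` of a function node in the bipartite graph `g`. -/
def nbr (g : V → F → Bool) (a : F) : Finset V := univ.filter fun i => g i a = true

/-- `Y_a` depends on `X` only through `X_{∂a}`. -/
def QLocal (g : V → F → Bool) (Q : F → 𝒴 → (V → 𝒳) → ℝ) : Prop :=
  ∀ a y x x', (∀ i ∈ nbr g a, x i = x' i) → Q a y x = Q a y x'

/-- The kernel of `Y_a` is invariant under permutations of its arguments `x_{∂a}`. -/
def QSym (g : V → F → Bool) (Q : F → 𝒴 → (V → 𝒳) → ℝ) : Prop :=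
  ∀ a y (x : V → 𝒳) (σ : Equiv.Perm V), (∀ i, g i a = g (σ i) a) → Q a y (x ∘ σ) = Q a y x

/-- A probability kernel `T` (with finite output alphabet `𝒜`) from `β` is `M`-soft:
mutual absolute continuity of the rows together with the bound
`∑_y (T(y|x₁)/T(y|x₂)) T(y|x) ≤ M`. -/
def SoftKer {𝒜 β : Type*} [Fintype 𝒜] (M : ℝ) (T : 𝒜 → β → ℝ) : Prop :=
  (∀ y x₁ x₂, T y x₂ = 0 → T y x₁ = 0) ∧
    ∀ x x₁ x₂, ∑ y, T y x₁ / T y x₂ * T y x ≤ M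

/-- Weight of the bipartite graph `g` in the ensemble where each edge is present
independently with probability `pe`. -/
def gW (pe : ℝ) (g : V → F → Bool) : ℝ := ∏ i, ∏ a, if g i a then pe else 1 - pe

/-- Expectation over the random bipartite graph with iid edges of probability `pe`. -/
noncomputable def expG (pe : ℝ) (f : (V → F → Bool) → ℝ) : ℝ :=
  ∑ g : V → F → Bool, gW pe g * f g

/-- A degree-indexed family of observation kernels `Q^{(k)}(·|x_1,…,x_k)`:
nonnegative, normalized, and invariant under permutations of the arguments. -/
def IsQFam (Qf : ∀ k : ℕ, 𝒴 → (Fin k → 𝒳) → ℝ) : Prop :=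
  (∀ k y v, 0 ≤ Qf k y v) ∧ (∀ k v, ∑ y, Qf k y v = 1) ∧
    ∀ k y (v : Fin k → 𝒳) (σ : Equiv.Perm (Fin k)), Qf k y (v ∘ σ) = Qf k y v

/-- The kernel of the observation `Y_a` induced on the graph `g` by the degree-indexed
family `Qf`: it is `Q^{(|∂a|)}` applied to `x_{∂a}`. -/
def QG [LinearOrder V] (Qf : ∀ k : ℕ, 𝒴 → (Fin k → 𝒳) → ℝ) (g : V → F → Bool) (a : F)
    (y : 𝒴) (x : V → 𝒳) : ℝ :=
  Qf ((nbr g a).sort (· ≤ ·)).length y fun l => x (((nbr g a).sort (· ≤ ·)).get l)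

/-- Variable nodes within (graph) distance `t` of the variable node `i`, where distance
is measured by the number of function nodes traversed. -/
def varBall (g : V → F → Bool) (i : V) : ℕ → Finset V
  | 0 => {i}
  | t+1 => varBall g i t ∪
      univ.filter fun j => ∃ a, g j a = true ∧ ∃ k ∈ varBall g i t, g k a = true

/-- Function nodes of the radius-`t` neighbourhood of `i`: those adjacent to a variable
node at distance at most `t - 1` from `i`. -/
def funBall (g : V → F → Bool) (i : V) : ℕ → Finset F
  | 0 => ∅
  | t+1 => univ.filter fun a => ∃ j ∈ varBall g i t, g j a = true

end Core

end PaperObs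
namespace PaperObs

section Derivative

variable {V F 𝒳 𝒴 𝒵 : Type*} [Fintype V] [Fintype F] [DecidableEq 𝒳]

/-- The part of the reveal-perturbation factor that depends on the parameter. -/
def revealWeight {𝒳 : Type*} (t : ℝ) (o : Option 𝒳) : ℝ := o.elim (1 - t) fun _ => t

lemma pert_eq_revealWeight_mul (t : ℝ) (o : Option 𝒳) (x : 𝒳) :
    pert t o x = revealWeight t o * if o = none ∨ o = some x then 1 else 0 := by
  cases o <;> simp [pert, revealWeight]

lemma hasDerivAt_revealWeight {𝒳 : Type*} (t : ℝ) (o : Option 𝒳) :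
    HasDerivAt (fun t => revealWeight t o) (revealWeight 1 o - revealWeight 0 o) t := by
  cases o with
  | none => simpa [revealWeight] using (hasDerivAt_id t).const_sub 1
  | some ξ => simpa [revealWeight] using hasDerivAt_id' t

/-- The part of the joint density that does not depend on the perturbation parameters. -/
def baseDensity (p : 𝒳 → ℝ) (Q : F → 𝒴 → (V → 𝒳) → ℝ) (R : 𝒵 → 𝒳 → ℝ)
    (x : V → 𝒳) (y : F → 𝒴) (z : V → 𝒵 × Option 𝒳) : ℝ :=
  (∏ i, p (x i)) * (∏ a, Q a (y a) x) *
    ∏ i, (R (z i).1 (x i) * if (z i).2 = none ∨ (z i).2 = some (x i) then 1 else 0)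

lemma jointSub_eq_mul_baseDensity (p : 𝒳 → ℝ) (Q : F → 𝒴 → (V → 𝒳) → ℝ) (R : 𝒵 → 𝒳 → ℝ)
    (θv : V → ℝ) (x : V → 𝒳) (y : F → 𝒴) (z : V → 𝒵 × Option 𝒳) :
    jointSub p Q R θv univ univ x y z =
      (∏ i, revealWeight (θv i) (z i).2) * baseDensity p Q R x y z := by
  simp only [jointSub, baseDensity, pert_eq_revealWeight_mul, Finset.prod_mul_distrib]
  ring

lemma sum_negMulLog_const_mul {ι : Type*} (s : Finset ι) (c : ℝ) (f : ι → ℝ) :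
    ∑ x ∈ s, Real.negMulLog (c * f x) - Real.negMulLog (∑ x ∈ s, c * f x) =
      c * (∑ x ∈ s, Real.negMulLog (f x) - Real.negMulLog (∑ x ∈ s, f x)) := by
  rw [← Finset.mul_sum]
  simp only [Real.negMulLog_mul, Finset.sum_add_distrib, ← Finset.sum_mul, ← Finset.mul_sum]
  ring

variable [DecidableEq V]

lemma jointSub_eq_mul_erase (p : 𝒳 → ℝ) (Q : F → 𝒴 → (V → 𝒳) → ℝ) (R : 𝒵 → 𝒳 → ℝ)
    (θv : V → ℝ) (i : V) (x : V → 𝒳) (y : F → 𝒴) (z : V → 𝒵 × Option 𝒳) :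
    jointSub p Q R θv univ univ x y z =
      pert (θv i) (z i).2 (x i) * ((∏ j, p (x j)) * (∏ a, Q a (y a) x) * R (z i).1 (x i) *
        ∏ j ∈ univ.erase i, (R (z j).1 (x j) * pert (θv j) (z j).2 (x j))) := by
  rw [jointSub, ← Finset.mul_prod_erase univ
    (fun j => R (z j).1 (x j) * pert (θv j) (z j).2 (x j)) (Finset.mem_univ i)]
  ring

lemma jointSub_update_zero_of_some (p : 𝒳 → ℝ) (Q : F → 𝒴 → (V → 𝒳) → ℝ) (R : 𝒵 → 𝒳 → ℝ)
    (θv : V → ℝ) (i : V) (x : V → 𝒳) (y : F → 𝒴) (z : V → 𝒵 × Option 𝒳) (ζ : 𝒵) (ξ : 𝒳) :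
    jointSub p Q R (Function.update θv i 0) univ univ x y
      (Function.update z i (ζ, some ξ)) = 0 := by
  simp [jointSub_eq_mul_erase p Q R _ i, pert]

lemma jointSub_update_one_of_none (p : 𝒳 → ℝ) (Q : F → 𝒴 → (V → 𝒳) → ℝ) (R : 𝒵 → 𝒳 → ℝ)
    (θv : V → ℝ) (i : V) (x : V → 𝒳) (y : F → 𝒴) (z : V → 𝒵 × Option 𝒳) (hz : (z i).2 = none) :
    jointSub p Q R (Function.update θv i 1) univ univ x y z = 0 := by
  simp [jointSub_eq_mul_erase p Q R _ i, pert, hz]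

/-- Revealing `X_i` as `ξ` amounts to restricting to `X_i = ξ`. -/
lemma jointSub_update_one_of_some (p : 𝒳 → ℝ) (Q : F → 𝒴 → (V → 𝒳) → ℝ) (R : 𝒵 → 𝒳 → ℝ)
    (θv : V → ℝ) (i : V) (x : V → 𝒳) (y : F → 𝒴) (z : V → 𝒵 × Option 𝒳) (hz : (z i).2 = none)
    (ξ : 𝒳) :
    jointSub p Q R (Function.update θv i 1) univ univ x y
        (Function.update z i ((z i).1, some ξ)) =
      if x i = ξ then jointSub p Q R (Function.update θv i 0) univ univ x y z else 0 := by
  have hprod : ∏ j ∈ univ.erase i, (R (Function.update z i ((z i).1, some ξ) j).1 (x j) *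
        pert (Function.update θv i 1 j) (Function.update z i ((z i).1, some ξ) j).2 (x j)) =
      ∏ j ∈ univ.erase i, (R (z j).1 (x j) * pert (Function.update θv i 0 j) (z j).2 (x j)) := by
    refine Finset.prod_congr rfl fun j hj => ?_
    simp [Function.update_of_ne (Finset.ne_of_mem_erase hj)]
  rw [jointSub_eq_mul_erase p Q R _ i, jointSub_eq_mul_erase p Q R _ i, hprod]
  by_cases h : x i = ξ
  · simp [pert, hz, h]
  · simp [pert, h, Ne.symm h]

variable [Fintype 𝒳] [Fintype 𝒴] [Fintype 𝒵] [DecidableEq F]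

/-- The conditional entropy is a multi-affine function of the perturbation parameters. -/
lemma condEnt_eq_sum_revealWeight (p : 𝒳 → ℝ) (Q : F → 𝒴 → (V → 𝒳) → ℝ) (R : 𝒵 → 𝒳 → ℝ)
    (θv : V → ℝ) :
    condEnt p Q R θv = ∑ y : F → 𝒴, ∑ z : V → 𝒵 × Option 𝒳,
      (∏ i, revealWeight (θv i) (z i).2) *
        (∑ x, Real.negMulLog (baseDensity p Q R x y z) -
          Real.negMulLog (∑ x, baseDensity p Q R x y z)) := by
  simp only [condEnt, jointSub_eq_mul_baseDensity, ← sum_negMulLog_const_mul,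
    Finset.sum_sub_distrib]
  congr 1
  rw [Finset.sum_comm]
  exact Finset.sum_congr rfl fun y _ => Finset.sum_comm

lemma hasDerivAt_condEnt (p : 𝒳 → ℝ) (Q : F → 𝒴 → (V → 𝒳) → ℝ) (R : 𝒵 → 𝒳 → ℝ) (θ : ℝ) :
    HasDerivAt (fun t : ℝ => condEnt p Q R (fun _ => t))
      (∑ i, (condEnt p Q R (Function.update (fun _ => θ) i 1) -
        condEnt p Q R (Function.update (fun _ => θ) i 0))) θ := by
  have hprod (z : V → 𝒵 × Option 𝒳) :
      HasDerivAt (fun t : ℝ => ∏ i, revealWeight t (z i).2)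
        (∑ i, (∏ j, revealWeight (Function.update (fun _ : V => θ) i 1 j) (z j).2 -
          ∏ j, revealWeight (Function.update (fun _ : V => θ) i 0 j) (z j).2)) θ := by
    refine (HasDerivAt.fun_finsetProd fun i _ =>
      hasDerivAt_revealWeight θ (z i).2).congr_deriv ?_
    refine Finset.sum_congr rfl fun i _ => ?_
    have hupdate (c : ℝ) : ∏ j, revealWeight (Function.update (fun _ : V => θ) i c j) (z j).2 =
        revealWeight c (z i).2 * ∏ j ∈ univ.erase i, revealWeight θ (z j).2 := by
      rw [← Finset.mul_prod_erase univ _ (Finset.mem_univ i), Function.update_self]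
      congr 1
      refine Finset.prod_congr rfl fun j hj => ?_
      rw [Function.update_of_ne (Finset.ne_of_mem_erase hj)]
    rw [hupdate, hupdate, smul_eq_mul]
    ring
  simp only [condEnt_eq_sum_revealWeight]
  refine (HasDerivAt.fun_sum fun y _ => HasDerivAt.fun_sum fun z _ =>
    (hprod z).mul_const _).congr_deriv ?_
  simp only [← Finset.sum_sub_distrib, ← sub_mul]
  symm
  rw [Finset.sum_comm]
  refine Finset.sum_congr rfl fun y _ => ?_
  rw [Finset.sum_comm]
  simp only [Finset.sum_mul]

/-- Sum over observation vectors, split according to the revealed value at `i`. -/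
lemma sum_eq_sum_reveal (i : V) (f : (V → 𝒵 × Option 𝒳) → ℝ) :
    ∑ z, f z = ∑ z with (z i).2 = none,
      (f z + ∑ ξ : 𝒳, f (Function.update z i ((z i).1, some ξ))) := by
  rw [← Finset.sum_fiberwise univ (fun z => (z i).2) f, Fintype.sum_option,
    Finset.sum_add_distrib, Finset.sum_comm (t := (univ : Finset 𝒳))]
  congr 1
  refine Finset.sum_congr rfl fun ξ _ => ?_
  refine Finset.sum_bij' (fun z _ => Function.update z i ((z i).1, none))
    (fun z _ => Function.update z i ((z i).1, some ξ)) (by simp) (by simp) ?_ ?_ ?_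
  all_goals
    intro z hz
    have hz' : z i = ((z i).1, (z i).2) := rfl
    rw [(Finset.mem_filter.mp hz).2] at hz'
    simp [← hz']

/-- Chain rule: revealing `X_i` lowers the conditional entropy of `X` by that of `X_i`. -/
lemma condEnt_update_one_sub_condEnt_update_zero (p : 𝒳 → ℝ) (Q : F → 𝒴 → (V → 𝒳) → ℝ)
    (R : 𝒵 → 𝒳 → ℝ) (θv : V → ℝ) (i : V) :
    condEnt p Q R (Function.update θv i 1) - condEnt p Q R (Function.update θv i 0) =
      -condEnt1 p Q R (Function.update θv i 0) i := by
  have hjoint (x : V → 𝒳) (y : F → 𝒴) :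
      ∑ z, Real.negMulLog (jointSub p Q R (Function.update θv i 1) univ univ x y z) =
        ∑ z, Real.negMulLog (jointSub p Q R (Function.update θv i 0) univ univ x y z) := by
    rw [sum_eq_sum_reveal i, sum_eq_sum_reveal i]
    refine Finset.sum_congr rfl fun z hz => ?_
    have hz := (Finset.mem_filter.mp hz).2
    simp [jointSub_update_zero_of_some, jointSub_update_one_of_none _ _ _ _ _ _ _ _ hz,
      jointSub_update_one_of_some _ _ _ _ _ _ _ _ hz, apply_ite Real.negMulLog]
  have hobs (y : F → 𝒴) :
      ∑ z, Real.negMulLog (∑ x, jointSub p Q R (Function.update θv i 1) univ univ x y z) =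
        ∑ ξ, ∑ z, Real.negMulLog (∑ x : V → 𝒳, if x i = ξ then
          jointSub p Q R (Function.update θv i 0) univ univ x y z else 0) := by
    rw [Finset.sum_comm, sum_eq_sum_reveal i, sum_eq_sum_reveal i]
    refine Finset.sum_congr rfl fun z hz => ?_
    have hz := (Finset.mem_filter.mp hz).2
    simp [jointSub_update_zero_of_some, jointSub_update_one_of_none _ _ _ _ _ _ _ _ hz,
      jointSub_update_one_of_some _ _ _ _ _ _ _ _ hz]
  simp only [condEnt, condEnt1, hjoint, hobs]
  rw [Finset.sum_comm (s := (univ : Finset (F → 𝒴))) (t := (univ : Finset 𝒳))]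
  ring

end Derivative

/-- first `θ`-derivative of the conditional entropy,
Eq. (3.2) of the paper.  For an observation system on a bipartite graph `G = (V,F,E)`,
the conditional entropy `H(X | Y, Z(θ))` is differentiable in `θ` with
`d/dθ H(X | Y, Z(θ)) = - ∑_{i ∈ V} H(X_i | Y, Z^{(i)}(θ))`,
where `Z^{(i)}(θ)` is obtained from `Z(θ)` by replacing `Z_i(θ)` with `(Z_i, ∗)`
(equivalently, by setting the perturbation parameter of node `i` to `0`). -/
theorem statement_4 {V F 𝒳 𝒴 𝒵 : Type} [Fintype V] [DecidableEq V] [Fintype F]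
    [DecidableEq F] [Fintype 𝒳] [DecidableEq 𝒳] [Fintype 𝒴] [DecidableEq 𝒴] [Fintype 𝒵]
    (p : 𝒳 → ℝ) (Q : F → 𝒴 → (V → 𝒳) → ℝ) (R : 𝒵 → 𝒳 → ℝ)
    (hp : IsPdist p) (hQ : IsKernelQ Q) (hR : IsKernelR R)
    (g : V → F → Bool) (hQloc : QLocal g Q) (hQsym : QSym g Q)
    (θ : ℝ) (hθ : θ ∈ Set.Icc (0:ℝ) 1) :
    HasDerivAt (fun t : ℝ => condEnt p Q R (fun _ => t))
      (- ∑ i : V, condEnt1 p Q R (fun j => if j = i then 0 else θ) i) θ := by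
  refine (hasDerivAt_condEnt p Q R θ).congr_deriv ?_
  rw [← Finset.sum_neg_distrib]
  refine Finset.sum_congr rfl fun i _ => ?_
  rw [condEnt_update_one_sub_condEnt_update_zero]
  congr 2
  funext j
  exact Function.update_apply _ _ _ _

end PaperObs
end

section
/- Let 𝖡(i,t) be the radius-t neighborhood of a fixed variable node i in a random bipartite graph G from the ensemble 𝒢(n, αn, γ/n), viewed as a labeled subgraph, and let 𝖳(t) be the Galton–Watson tree of depth t in which each variable node has a Poisson(γα) number of function-node children and each function node has an independent Poisson(γ) number of variable-node children. For any fixed labeled rooted tree T_*, writing 𝖡(i,t) ≃ T_* if T_* is obtained from 𝖡(i,t) by a canonical depth-first relabeling, one has lim_{n→∞} P{𝖡(i,t) ≃ T_*} = P{𝖳(t) ≃ T_*}. -/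
open Finset MeasureTheory Filter

open scoped Classical

namespace PaperObs

/-- Rooted trees with alternating variable/function levels: a variable node carries a
list of function-node children, each function node carrying a list of variable
subtrees. -/
inductive BTree : Type
  | node : List (List BTree) → BTree

/-- `l` and `l'` are related by a permutation matching their elements through `r`. -/
def listPermRel {α : Type*} (r : α → α → Prop) (l l' : List α) : Prop :=
  ∃ l₂, List.Perm l₂ l' ∧ List.Forall₂ r l l₂

/-- Isomorphism of depth-`t` rooted trees as *unordered* trees (this is the relation
`𝖡(i,t) ≃ T_*` after the canonical depth-first relabeling). -/
def varEquiv : ℕ → BTree → BTree → Prop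
  | 0, T, T' => T = BTree.node [] ∧ T' = BTree.node []
  | t+1, BTree.node cs, BTree.node cs' => listPermRel (listPermRel (varEquiv t)) cs cs'

section Explore

variable {n m : ℕ}

/-- Function-node children of the variable node `i` (excluding the parent `pa`),
listed in increasing label order. -/
def funCh (g : Fin n → Fin m → Bool) (i : Fin n) (pa : Option (Fin m)) : List (Fin m) :=
  ((Finset.univ.filter fun a => g i a = true ∧ some a ≠ pa).sort (· ≤ ·))

/-- Variable-node children of the function node `a` (excluding the parent `i`),
listed in increasing label order. -/
def varCh (g : Fin n → Fin m → Bool) (a : Fin m) (i : Fin n) : List (Fin n) :=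
  ((Finset.univ.filter fun j => g j a = true ∧ j ≠ i).sort (· ≤ ·))

/-- Non-backtracking exploration of the radius-`t` neighbourhood `𝖡(i,t)` of `i`,
returning the explored rooted tree. -/
def exploreV (g : Fin n → Fin m → Bool) : ℕ → Fin n → Option (Fin m) → BTree
  | 0, _, _ => BTree.node []
  | t+1, i, pa =>
      BTree.node ((funCh g i pa).map fun a =>
        (varCh g a i).map fun j => exploreV g t j (some a))

/-- Variable nodes visited by the exploration (with multiplicity). -/
def visitedV (g : Fin n → Fin m → Bool) : ℕ → Fin n → Option (Fin m) → List (Fin n)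
  | 0, i, _ => [i]
  | t+1, i, pa =>
      i :: ((funCh g i pa).map fun a =>
        ((varCh g a i).map fun j => visitedV g t j (some a)).flatten).flatten

/-- Function nodes visited by the exploration (with multiplicity). -/
def visitedF (g : Fin n → Fin m → Bool) : ℕ → Fin n → Option (Fin m) → List (Fin m)
  | 0, _, _ => []
  | t+1, i, pa =>
      ((funCh g i pa).map fun a =>
        a :: ((varCh g a i).map fun j => visitedF g t j (some a)).flatten).flatten

end Explore

/-- Poisson(`r`) probability mass function. -/
noncomputable def poissonReal (r : ℝ) (k : ℕ) : ℝ := Real.exp (-r) * r ^ k / k.factorial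

/-- Probability that the Galton–Watson tree `𝖳(t)` (variable nodes with Poisson(γα)
function-node children, function nodes with Poisson(γ) variable-node children), sampled
with its children in generation order, equals the given *ordered* tree. -/
noncomputable def gwW (γ α : ℝ) : ℕ → BTree → ℝ
  | 0, BTree.node cs => if cs.isEmpty then 1 else 0
  | t+1, BTree.node cs =>
      poissonReal (γ * α) cs.length *
        (cs.map fun f => poissonReal γ f.length * (f.map (gwW γ α t)).prod).prod

section Forest

/-- Forests hanging below a node, explored down to depth `s`, with all nodes labelled in `X`. -/
def LForest (X : Type) : ℕ → Type
  | 0 => Unit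
  | s + 1 => List (X × LForest X s)

/-- Unlabelled ordered forests of depth at most `s`. -/
def Shape : ℕ → Type
  | 0 => Unit
  | s + 1 => List (Shape s)

variable {X : Type}

/-- The children of the root, together with the forests below them. -/
def LForest.kids {s : ℕ} (S : LForest X (s + 1)) : List (X × LForest X s) := S

/-- The forest with the given children of the root. -/
def LForest.ofKids {s : ℕ} (S : List (X × LForest X s)) : LForest X (s + 1) := S

/-- The children of the root. -/
def Shape.kids {s : ℕ} (T : Shape (s + 1)) : List (Shape s) := T

/-- The shape with the given children of the root. -/
def Shape.ofKids {s : ℕ} (T : List (Shape s)) : Shape (s + 1) := T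

@[simp] theorem LForest.kids_ofKids {s : ℕ} (S : List (X × LForest X s)) :
    (LForest.ofKids S).kids = S := rfl

@[simp] theorem Shape.kids_ofKids {s : ℕ} (T : List (Shape s)) :
    (Shape.ofKids T).kids = T := rfl

/-- Forget the labels of a forest. -/
def LForest.shape : (s : ℕ) → LForest X s → Shape s
  | 0, _ => ()
  | s + 1, S => Shape.ofKids <| List.map (fun c => LForest.shape s c.2) S.kids

/-- Labels, in depth-first order, of the tree with root `x` and forest `S` below it. -/
def LForest.labels : (s : ℕ) → X → LForest X s → List X
  | 0, x, _ => [x]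
  | s + 1, x, S => x :: S.kids.flatMap fun c => LForest.labels s c.1 c.2

/-- The lists of children labels of the internal nodes, in depth-first order. -/
def LForest.blocks : (s : ℕ) → LForest X s → List (List X)
  | 0, _ => []
  | s + 1, S => S.kids.map Prod.fst :: S.kids.flatMap fun c => LForest.blocks s c.2

/-- The internal nodes, in depth-first order. -/
def LForest.internal : (s : ℕ) → X → LForest X s → List X
  | 0, _, _ => []
  | s + 1, x, S => x :: S.kids.flatMap fun c => LForest.internal s c.1 c.2

/-- Sides and numbers of children of the internal nodes, in depth-first order, sides
alternating along the levels. -/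
def Shape.degs : Bool → (s : ℕ) → Shape s → List (Bool × ℕ)
  | _, 0, _ => []
  | b, s + 1, T => (b, T.kids.length) :: T.kids.flatMap fun c => Shape.degs (!b) s c

/-- The list of all nodes of the tree together with their neighbours, the root `x` having
the additional neighbour `pa`. -/
def LForest.nbrs : (s : ℕ) → X → Option X → LForest X s → List (X × List X)
  | 0, x, pa, _ => [(x, pa.toList)]
  | s + 1, x, pa, S => (x, pa.toList ++ S.kids.map Prod.fst) ::
      S.kids.flatMap fun c => LForest.nbrs s c.1 (some x) c.2

/-- The sublist of `LForest.nbrs` of internal nodes. -/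
def LForest.innerNbrs : (s : ℕ) → X → Option X → LForest X s → List (X × List X)
  | 0, _, _, _ => []
  | s + 1, x, pa, S => (x, pa.toList ++ S.kids.map Prod.fst) ::
      S.kids.flatMap fun c => LForest.innerNbrs s c.1 (some x) c.2

/-- Adjacency in the tree with root `x` and forest `S` below it. -/
def LForest.Edge : (s : ℕ) → X → LForest X s → X → X → Prop
  | 0, _, _, _, _ => False
  | s + 1, x, S, y, z => ∃ c ∈ S.kids,
      (y = x ∧ z = c.1) ∨ (y = c.1 ∧ z = x) ∨ LForest.Edge s c.1 c.2 y z

/-- Children of every node lie on the opposite side. -/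
def LForest.Sided (side : X → Bool) : (s : ℕ) → X → LForest X s → Prop
  | 0, _, _ => True
  | s + 1, x, S => ∀ c ∈ S.kids,
      side c.1 = !side x ∧ LForest.Sided side s c.1 c.2

open LForest

theorem labels_eq_cons (s : ℕ) (x : X) (S : LForest X s) :
    ∃ l, labels s x S = x :: l := by
  cases s <;> exact ⟨_, rfl⟩

theorem labels_perm (s : ℕ) (x : X) (S : LForest X s) :
    (labels s x S).Perm (x :: (blocks s S).flatten) := by
  induction s generalizing x with
  | zero => exact List.Perm.refl _
  | succ s ih =>
    refine List.Perm.cons x ?_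
    simp only [blocks, List.flatten_cons]
    induction S.kids with
    | nil => exact List.Perm.refl _
    | cons c l ihl =>
      simp only [List.flatMap_cons, List.map_cons, List.flatten_append, List.cons_append]
      refine ((ih c.1 c.2).append ihl).trans ?_
      rw [List.cons_append]
      refine List.Perm.cons _ ?_
      rw [← List.append_assoc, ← List.append_assoc]
      exact List.Perm.append_right _ List.perm_append_comm

theorem labels_sublist_flatMap {s : ℕ} {S : List (X × LForest X s)} {c : X × LForest X s}
    (hc : c ∈ S) : (labels s c.1 c.2).Sublist (S.flatMap fun c => labels s c.1 c.2) := by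
  exact List.sublist_flatten_of_mem (List.mem_map_of_mem (f := fun c => labels s c.1 c.2) hc)

theorem map_fst_sublist_flatMap {s : ℕ} (S : List (X × LForest X s)) :
    (S.map Prod.fst).Sublist (S.flatMap fun c => labels s c.1 c.2) := by
  induction S with
  | nil => simp
  | cons c l ih =>
    obtain ⟨l', h⟩ := labels_eq_cons s c.1 c.2
    simp only [List.map_cons, List.flatMap_cons, h, List.cons_append]
    exact (ih.trans (List.sublist_append_right _ _)).cons_cons _

theorem nodup_child {s : ℕ} {x : X} {pa : Option X} {S : LForest X (s + 1)}
    (h : (pa.toList ++ labels (s + 1) x S).Nodup) {c : X × LForest X s} (hc : c ∈ S.kids) :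
    ((some x).toList ++ labels s c.1 c.2).Nodup :=
  h.sublist (((labels_sublist_flatMap hc).cons_cons x).trans (List.sublist_append_right _ _))

theorem nodup_neighbours {s : ℕ} {x : X} {pa : Option X} {S : LForest X (s + 1)}
    (h : (pa.toList ++ labels (s + 1) x S).Nodup) :
    (pa.toList ++ S.kids.map Prod.fst).Nodup :=
  h.sublist (List.Sublist.append_left (((map_fst_sublist_flatMap S.kids).cons x)) _)

theorem shape_degs_eq (b : Bool) (s : ℕ) (S : LForest X s) :
    ((shape s S).degs b s).map Prod.snd = (blocks s S).map List.length := by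
  induction s generalizing b with
  | zero => rfl
  | succ s ih =>
    simp only [Shape.degs, shape, blocks, Shape.kids_ofKids, List.map_cons, List.length_map,
      List.flatMap_map, List.map_flatMap, ih]

theorem exists_forest_of_lengths {b : Bool} (s : ℕ) (T : Shape s) (W : List (List X))
    (h : W.map List.length = (T.degs b s).map Prod.snd) :
    ∃ S : LForest X s, shape s S = T ∧ blocks s S = W := by
  induction s generalizing b W with
  | zero =>
    refine ⟨(), rfl, ?_⟩
    have : W = [] := by simpa [Shape.degs] using h
    exact this.symm
  | succ s ih =>
    have key : ∀ (T : List (Shape s)) (w : List X) (W : List (List X)),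
        w.length = T.length →
        W.map List.length = (T.flatMap fun c => Shape.degs (!b) s c).map Prod.snd →
        ∃ S : List (X × LForest X s), S.map (fun c => shape s c.2) = T ∧
          S.map Prod.fst = w ∧ S.flatMap (fun c => blocks s c.2) = W := by
      intro T
      induction T with
      | nil =>
        intro w W hw hW
        refine ⟨[], rfl, ?_, ?_⟩
        · simpa [eq_comm] using hw
        · simpa [eq_comm] using hW
      | cons T₀ T ihT =>
        intro w W hw hW
        cases w with
        | nil => simp at hw
        | cons x w =>
          simp only [List.flatMap_cons, List.map_append] at hW
          obtain ⟨W₁, W₂, rfl, h₁, h₂⟩ := List.map_eq_append_iff.1 hW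
          obtain ⟨S₀, hS₀, hS₀'⟩ := ih T₀ W₁ h₁
          obtain ⟨S, hS, hS', hS''⟩ := ihT w W₂ (by simpa using hw) h₂
          exact ⟨(x, S₀) :: S, by simp [hS₀, hS], by simp [hS'], by simp [hS₀', hS'']⟩
    cases W with
    | nil => simp [Shape.degs] at h
    | cons w W =>
      simp only [Shape.degs, List.map_cons, List.cons.injEq] at h
      obtain ⟨S, h₁, h₂, h₃⟩ := key T.kids w W h.1 h.2
      refine ⟨LForest.ofKids S, congrArg Shape.ofKids h₁, ?_⟩
      simp only [blocks, kids_ofKids, h₂, h₃]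

theorem forest_ext (s : ℕ) (S S' : LForest X s) (h : shape s S = shape s S')
    (h' : blocks s S = blocks s S') : S = S' := by
  induction s with
  | zero => rfl
  | succ s ih =>
    have key : ∀ S S' : List (X × LForest X s),
        S.map (fun c => shape s c.2) = S'.map (fun c => shape s c.2) →
        S.map Prod.fst = S'.map Prod.fst →
        S.flatMap (fun c => blocks s c.2) = S'.flatMap (fun c => blocks s c.2) → S = S' := by
      intro S
      induction S with
      | nil =>
        intro S' h _ _
        exact (List.map_eq_nil_iff.1 h.symm).symm
      | cons c S ihS =>
        intro S' h₁ h₂ h₃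
        cases S' with
        | nil => simp at h₁
        | cons c' S' =>
          simp only [List.map_cons, List.cons.injEq, List.flatMap_cons] at h₁ h₂ h₃
          have hl : (blocks s c.2).length = (blocks s c'.2).length := by
            have e := shape_degs_eq true s c.2
            rw [h₁.1, shape_degs_eq true s c'.2] at e
            simpa using (congrArg List.length e).symm
          obtain ⟨e₁, e₂⟩ := List.append_inj h₃ hl
          rw [ihS S' h₁.2 h₂.2 e₂]
          exact congrArg (· :: S') (Prod.ext h₂.1 (ih _ _ h₁.1 e₁))
    simp only [blocks, List.cons.injEq] at h'
    exact key S.kids S'.kids h h'.1 h'.2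

theorem nbrs_map_fst (s : ℕ) (x : X) (pa : Option X) (S : LForest X s) :
    (nbrs s x pa S).map Prod.fst = labels s x S := by
  induction s generalizing x pa with
  | zero => rfl
  | succ s ih => simp only [nbrs, labels, List.map_cons, List.map_flatMap, ih]

theorem innerNbrs_map_fst (s : ℕ) (x : X) (pa : Option X) (S : LForest X s) :
    (innerNbrs s x pa S).map Prod.fst = internal s x S := by
  induction s generalizing x pa with
  | zero => rfl
  | succ s ih => simp only [innerNbrs, internal, List.map_cons, List.map_flatMap, ih]

theorem innerNbrs_sublist (s : ℕ) (x : X) (pa : Option X) (S : LForest X s) :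
    (innerNbrs s x pa S).Sublist (nbrs s x pa S) := by
  induction s generalizing x pa with
  | zero => exact List.nil_sublist _
  | succ s ih =>
    refine List.Sublist.cons_cons _ ?_
    induction S.kids with
    | nil => exact List.nil_sublist _
    | cons c S ihS => exact (ih c.1 (some x) c.2).append ihS

theorem internal_sublist (s : ℕ) (x : X) (S : LForest X s) :
    (internal s x S).Sublist (labels s x S) := by
  rw [← innerNbrs_map_fst s x none, ← nbrs_map_fst s x none]
  exact (innerNbrs_sublist s x none S).map _

theorem edge_symm (s : ℕ) (x : X) (S : LForest X s) {y z : X} (h : Edge s x S y z) :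
    Edge s x S z y := by
  induction s generalizing x with
  | zero => exact h.elim
  | succ s ih =>
    obtain ⟨c, hc, h⟩ := h
    refine ⟨c, hc, ?_⟩
    rcases h with h | h | h
    · exact .inr (.inl h.symm)
    · exact .inl h.symm
    · exact .inr (.inr (ih c.1 c.2 h))

theorem edge_side {side : X → Bool} (s : ℕ) (x : X) (S : LForest X s) (hS : Sided side s x S)
    {y z : X} (h : Edge s x S y z) : side z = !side y := by
  induction s generalizing x with
  | zero => exact h.elim
  | succ s ih =>
    obtain ⟨c, hc, h⟩ := h
    rcases h with ⟨rfl, rfl⟩ | ⟨rfl, rfl⟩ | h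
    · exact (hS c hc).1
    · simp [(hS c hc).1]
    · exact ih c.1 c.2 (hS c hc).2 h

theorem edge_internal (s : ℕ) (x : X) (S : LForest X s) {y z : X} (h : Edge s x S y z) :
    y ∈ internal s x S ∨ z ∈ internal s x S := by
  induction s generalizing x with
  | zero => exact h.elim
  | succ s ih =>
    obtain ⟨c, hc, h⟩ := h
    rcases h with ⟨rfl, -⟩ | ⟨-, rfl⟩ | h
    · exact .inl (List.mem_cons_self ..)
    · exact .inr (List.mem_cons_self ..)
    · exact (ih c.1 c.2 h).imp
        (fun h => List.mem_cons_of_mem _ (List.mem_flatMap.2 ⟨c, hc, h⟩))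
        (fun h => List.mem_cons_of_mem _ (List.mem_flatMap.2 ⟨c, hc, h⟩))

theorem exists_mem_nbrs_iff (s : ℕ) (x : X) (pa : Option X) (S : LForest X s) (y z : X) :
    (∃ q ∈ nbrs s x pa S, q.1 = y ∧ z ∈ q.2) ↔ (y = x ∧ pa = some z) ∨ Edge s x S y z := by
  induction s generalizing x pa with
  | zero =>
    simp [nbrs, Edge, eq_comm]
  | succ s ih =>
    have e : (∃ q ∈ nbrs (s + 1) x pa S, q.1 = y ∧ z ∈ q.2) ↔
        (x = y ∧ (z ∈ pa.toList ∨ ∃ c ∈ S.kids, c.1 = z)) ∨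
        ∃ c ∈ S.kids, ∃ q ∈ nbrs s c.1 (some x) c.2, q.1 = y ∧ z ∈ q.2 := by
      simp only [nbrs, List.mem_cons, exists_eq_or_imp, List.mem_append, List.mem_map,
        List.mem_flatMap]
      refine or_congr Iff.rfl ⟨?_, ?_⟩
      · rintro ⟨q, ⟨c, hc, hq⟩, h⟩
        exact ⟨c, hc, q, hq, h⟩
      · rintro ⟨c, hc, q, hq, h⟩
        exact ⟨q, ⟨c, hc, hq⟩, h⟩
    rw [e]
    simp only [ih, Option.mem_toList, Option.some.injEq]
    constructor
    · rintro (⟨rfl, h | ⟨c, hc, rfl⟩⟩ | ⟨c, hc, ⟨rfl, rfl⟩ | h⟩)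
      · exact .inl ⟨rfl, h⟩
      · exact .inr ⟨c, hc, .inl ⟨rfl, rfl⟩⟩
      · exact .inr ⟨c, hc, .inr (.inl ⟨rfl, rfl⟩)⟩
      · exact .inr ⟨c, hc, .inr (.inr h)⟩
    · rintro (⟨rfl, h⟩ | ⟨c, hc, ⟨rfl, rfl⟩ | ⟨rfl, rfl⟩ | h⟩)
      · exact .inl ⟨rfl, .inl h⟩
      · exact .inl ⟨rfl, .inr ⟨c, hc, rfl⟩⟩
      · exact .inr ⟨c, hc, .inl ⟨rfl, rfl⟩⟩
      · exact .inr ⟨c, hc, .inr h⟩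

theorem mem_nbrs_iff_edge {s : ℕ} {x : X} {S : LForest X s} (hnd : (labels s x S).Nodup)
    {q : X × List X} (hq : q ∈ nbrs s x none S) (z : X) :
    z ∈ q.2 ↔ Edge s x S q.1 z := by
  have h := exists_mem_nbrs_iff s x none S q.1 z
  simp only [reduceCtorEq, and_false, false_or] at h
  rw [← h]
  refine ⟨fun hz => ⟨q, hq, rfl, hz⟩, ?_⟩
  rintro ⟨q', hq', e, hz⟩
  rw [← nbrs_map_fst s x none] at hnd
  rwa [← List.inj_on_of_nodup_map hnd hq' hq e]

theorem nodup_of_mem_nbrs (s : ℕ) (x : X) (pa : Option X) (S : LForest X s)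
    (hnd : (pa.toList ++ labels s x S).Nodup) {q : X × List X} (hq : q ∈ nbrs s x pa S) :
    q.2.Nodup := by
  induction s generalizing x pa with
  | zero =>
    obtain rfl : q = (x, pa.toList) := by simpa [nbrs] using hq
    exact pa.toList_nodup
  | succ s ih =>
    rcases List.mem_cons.1 hq with rfl | hq
    · exact nodup_neighbours hnd
    · obtain ⟨c, hc, hq⟩ := List.mem_flatMap.1 hq
      exact ih c.1 (some x) c.2 (nodup_child hnd hc) hq

theorem sum_length_nbrs (s : ℕ) (x : X) (pa : Option X) (S : LForest X s) :
    ((nbrs s x pa S).map fun q => q.2.length).sum + 2 =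
      pa.toList.length + 2 * (labels s x S).length := by
  induction s generalizing x pa with
  | zero => simp [nbrs, labels]
  | succ s ih =>
    have key : ∀ S : List (X × LForest X s),
        ((S.flatMap fun c => nbrs s c.1 (some x) c.2).map fun q => q.2.length).sum + S.length =
          2 * (S.flatMap fun c => labels s c.1 c.2).length := by
      intro S
      induction S with
      | nil => rfl
      | cons c S ihS =>
        have := ih c.1 (some x) c.2
        simp only [List.flatMap_cons, List.map_append, List.sum_append, List.length_cons,
          List.length_append, Option.toList_some, List.length_nil] at this ihS ⊢
        omega
    have := key S.kids
    simp only [nbrs, labels, List.map_cons, List.sum_cons, List.length_append, List.length_map,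
      List.length_cons]
    omega

theorem internal_map_side {side : X → Bool} (s : ℕ) (x : X) (S : LForest X s)
    (hS : Sided side s x S) :
    (internal s x S).map side = ((shape s S).degs (side x) s).map Prod.fst := by
  induction s generalizing x with
  | zero => rfl
  | succ s ih =>
    simp only [internal, shape, Shape.degs, Shape.kids_ofKids, List.map_cons, List.map_flatMap,
      List.flatMap_map]
    refine congrArg (side x :: ·) (List.flatMap_congr fun c hc => ?_)
    rw [ih c.1 c.2 (hS c hc).2, (hS c hc).1]

end Forest

section Explore

open LForest

variable {X : Type} [LinearOrder X]

/-- An increasing list of `d.2` elements on the side opposite to `d.1`. -/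
def IsBlock (side : X → Bool) (d : Bool × ℕ) (l : List X) : Prop :=
  l.Pairwise (· < ·) ∧ l.length = d.2 ∧ ∀ y ∈ l, side y = !d.1

theorem pairwise_lt_sort (A : Finset X) : (A.sort (· ≤ ·)).Pairwise (· < ·) :=
  A.sortedLT_sort.pairwise

theorem sort_toFinset_of_pairwise {l : List X} (hl : l.Pairwise (· < ·)) :
    l.toFinset.sort (· ≤ ·) = l :=
  (List.toFinset_sort (· ≤ ·) hl.nodup).2 (hl.imp le_of_lt)

theorem map_mk_eq_iff {α β : Type*} (f : α → β) (l : List α) (K : List (α × β)) :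
    (l.map fun y => (y, f y)) = K ↔ l = K.map Prod.fst ∧ ∀ c ∈ K, f c.1 = c.2 := by
  constructor
  · rintro rfl
    simp [Function.comp_def]
  · rintro ⟨rfl, h⟩
    rw [List.map_map]
    conv_rhs => rw [← List.map_id K]
    exact List.map_congr_left fun c hc => Prod.ext rfl (h c hc)

theorem forall₂_append_split {α β : Type*} {R : α → β → Prop} {l₁ l₂ : List α} {m₁ m₂ : List β}
    (h : List.Forall₂ R (l₁ ++ l₂) (m₁ ++ m₂)) (hl : l₁.length = m₁.length) :
    List.Forall₂ R l₁ m₁ ∧ List.Forall₂ R l₂ m₂ := by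
  induction l₁ generalizing m₁ with
  | nil =>
    obtain rfl : m₁ = [] := by simpa [eq_comm] using hl
    exact ⟨.nil, h⟩
  | cons a l ih =>
    cases m₁ with
    | nil => simp at hl
    | cons b m =>
      obtain ⟨h₁, h₂⟩ := List.forall₂_cons.1 h
      obtain ⟨h₃, h₄⟩ := ih h₂ (by simpa using hl)
      exact ⟨.cons h₁ h₃, h₄⟩

theorem forall₂_flatMap_iff {α β γ : Type*} {R : α → β → Prop} {f : γ → List α} {g : γ → List β}
    (l : List γ) (hl : ∀ c, (f c).length = (g c).length) :
    List.Forall₂ R (l.flatMap f) (l.flatMap g) ↔ ∀ c ∈ l, List.Forall₂ R (f c) (g c) := by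
  induction l with
  | nil => simp
  | cons c l ih =>
    simp only [List.flatMap_cons, List.mem_cons, forall_eq_or_imp]
    rw [← ih]
    exact ⟨fun h => forall₂_append_split h (hl c), fun h => List.rel_append h.1 h.2⟩

theorem forall₂_blocks_succ_iff {side : X → Bool} {b : Bool} {s : ℕ} {S : LForest X (s + 1)} :
    List.Forall₂ (IsBlock side) ((shape (s + 1) S).degs b (s + 1)) (blocks (s + 1) S) ↔
      IsBlock side (b, S.kids.length) (S.kids.map Prod.fst) ∧
      ∀ c ∈ S.kids, List.Forall₂ (IsBlock side) ((shape s c.2).degs (!b) s) (blocks s c.2) := by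
  simp only [Shape.degs, shape, blocks, Shape.kids_ofKids, List.forall₂_cons, List.flatMap_map,
    List.length_map]
  refine and_congr_right fun _ => forall₂_flatMap_iff _ fun c => ?_
  simpa using congrArg List.length (shape_degs_eq (!b) s c.2)

theorem sided_of_forall₂ {side : X → Bool} (s : ℕ) (x : X) (S : LForest X s)
    (h : List.Forall₂ (IsBlock side) ((shape s S).degs (side x) s) (blocks s S)) :
    Sided side s x S := by
  induction s generalizing x with
  | zero => trivial
  | succ s ih =>
    rw [forall₂_blocks_succ_iff] at h
    intro c hc
    have hs : side c.1 = !side x := h.1.2.2 _ (List.mem_map_of_mem hc)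
    exact ⟨hs, ih _ _ (hs ▸ h.2 c hc)⟩

variable [Fintype X]

/-- Neighbours of `x` in the graph `G`, apart from `pa`, in increasing order. -/
noncomputable def children (G : X → X → Prop) (x : X) (pa : Option X) : List X :=
  (Finset.univ.filter fun y => G x y ∧ some y ≠ pa).sort (· ≤ ·)

/-- Non-backtracking exploration of the graph `G` from `x`, down to depth `s`. -/
noncomputable def explore (G : X → X → Prop) : (s : ℕ) → X → Option X → LForest X s
  | 0, _, _ => ()
  | s + 1, x, pa =>
      LForest.ofKids ((children G x pa).map fun y => (y, explore G s y (some x)))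

/-- Sequences of blocks with prescribed sides and sizes, pairwise disjoint and disjoint
from `A`. -/
noncomputable def words (side : X → Bool) :
    List (Bool × ℕ) → Finset X → Finset (List (List X))
  | [], _ => {[]}
  | d :: D, A => (Finset.powersetCard d.2 ((Finset.univ.filter fun y => side y = !d.1) \ A)).biUnion
      fun B => (words side D (A ∪ B)).image (B.sort (· ≤ ·) :: ·)

/-- The number of sequences of disjoint blocks with prescribed sides and sizes, when `N b`
elements are available on side `b`. -/
def numWords : List (Bool × ℕ) → (Bool → ℕ) → ℕ
  | [], _ => 1
  | d :: D, N => (N (!d.1)).choose d.2 * numWords D (Function.update N (!d.1) (N (!d.1) - d.2))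

theorem mem_children {G : X → X → Prop} {x : X} {pa : Option X} {y : X} :
    y ∈ children G x pa ↔ G x y ∧ some y ≠ pa := by
  simp [children]

theorem children_eq_of_mem_iff {G : X → X → Prop} {x : X} {pa : Option X} {l : List X}
    (hl : l.Pairwise (· < ·)) (h : ∀ z, z ∈ l ↔ G x z ∧ some z ≠ pa) : children G x pa = l := by
  rw [← sort_toFinset_of_pairwise hl, children]
  congr 1
  ext z
  simp [h]

theorem children_eq_iff {G : X → X → Prop} {x : X} {pa : Option X} {l : List X}
    (hl : l.Pairwise (· < ·)) (hpa : ∀ y, pa = some y → G x y) (hd : (pa.toList ++ l).Nodup) :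
    children G x pa = l ↔ ∀ z, G x z ↔ z ∈ pa.toList ++ l := by
  have hd' : ∀ z, pa = some z → z ∉ l := by
    rintro z rfl hz
    exact (List.nodup_cons.1 hd).1 hz
  have e : (∀ z, G x z ↔ z ∈ pa.toList ++ l) ↔ ∀ z, z ∈ children G x pa ↔ z ∈ l := by
    refine forall_congr' fun z => ?_
    rw [mem_children, List.mem_append, Option.mem_toList]
    have := hpa z
    have := hd' z
    rw [ne_comm]
    tauto
  rw [e]
  exact ⟨fun h z => by rw [h], fun h => children_eq_of_mem_iff hl fun z => by
    rw [← h, mem_children]⟩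

theorem explore_eq_iff {G : X → X → Prop} (hG : ∀ y z, G y z → G z y) (s : ℕ) (x : X)
    (pa : Option X) (S : LForest X s) (hS : ∀ l ∈ blocks s S, l.Pairwise (· < ·))
    (hnd : (pa.toList ++ labels s x S).Nodup) (hpa : ∀ y, pa = some y → G x y) :
    explore G s x pa = S ↔ ∀ q ∈ innerNbrs s x pa S, ∀ z, G q.1 z ↔ z ∈ q.2 := by
  induction s generalizing x pa with
  | zero => exact ⟨fun _ q hq => by simp [innerNbrs] at hq, fun _ => rfl⟩
  | succ s ih =>
    have e : explore G (s + 1) x pa = S ↔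
        (children G x pa).map (fun y => (y, explore G s y (some x))) = S.kids := Iff.rfl
    simp only [blocks, List.mem_cons, forall_eq_or_imp, List.mem_flatMap] at hS
    rw [e, map_mk_eq_iff, children_eq_iff hS.1 hpa (nodup_neighbours hnd)]
    simp only [innerNbrs, List.mem_cons, forall_eq_or_imp, List.mem_flatMap]
    refine and_congr_right fun hx => ?_
    have ih' : ∀ c ∈ S.kids, (explore G s c.1 (some x) = c.2 ↔
        ∀ q ∈ innerNbrs s c.1 (some x) c.2, ∀ z, G q.1 z ↔ z ∈ q.2) := by
      intro c hc
      refine ih c.1 (some x) c.2 (fun l hl => hS.2 l ⟨c, hc, hl⟩) (nodup_child hnd hc) ?_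
      rintro y ⟨⟩
      exact hG _ _ ((hx c.1).2 (List.mem_append_right _ (List.mem_map_of_mem hc)))
    constructor
    · rintro h q ⟨c, hc, hq⟩
      exact (ih' c hc).1 (h c hc) q hq
    · intro h c hc
      exact (ih' c hc).2 fun q hq => h q ⟨c, hc, hq⟩

theorem forall₂_blocks_explore {side : X → Bool} {G : X → X → Prop}
    (hG : ∀ y z, G y z → side z = !side y) (s : ℕ) (x : X) (pa : Option X) :
    List.Forall₂ (IsBlock side) ((shape s (explore G s x pa)).degs (side x) s)
      (blocks s (explore G s x pa)) := by
  induction s generalizing x pa with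
  | zero => exact .nil
  | succ s ih =>
    rw [forall₂_blocks_succ_iff]
    have e : (explore G (s + 1) x pa).kids =
      (children G x pa).map fun y => (y, explore G s y (some x)) := rfl
    have e' : (explore G (s + 1) x pa).kids.map Prod.fst = children G x pa := by
      simp [e, Function.comp_def]
    refine ⟨⟨?_, by simp, ?_⟩, ?_⟩
    · rw [e']
      exact pairwise_lt_sort _
    · rw [e']
      exact fun y hy => hG _ _ (mem_children.1 hy).1
    · rw [e]
      simp only [List.mem_map]
      rintro c ⟨y, hy, rfl⟩
      have := ih y (some x)
      rwa [hG _ _ (mem_children.1 hy).1] at this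

theorem mem_words {side : X → Bool} {D : List (Bool × ℕ)} {A : Finset X} {W : List (List X)} :
    W ∈ words side D A ↔ List.Forall₂ (IsBlock side) D W ∧ W.flatten.Nodup ∧
      ∀ y ∈ W.flatten, y ∉ A := by
  induction D generalizing A W with
  | nil =>
    simp only [words, Finset.mem_singleton, List.forall₂_nil_left_iff]
    exact ⟨fun h => by simp [h], fun h => h.1⟩
  | cons d D ih =>
    simp only [words, Finset.mem_biUnion, Finset.mem_powersetCard, Finset.mem_image, ih,
      List.forall₂_cons_left_iff]
    constructor
    · rintro ⟨B, ⟨hB, hBc⟩, W, ⟨hW, hnd, hA⟩, rfl⟩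
      have hB' : ∀ y ∈ B, side y = !d.1 ∧ y ∉ A := fun y hy => by simpa using hB hy
      refine ⟨⟨_, W, ⟨pairwise_lt_sort B, by simpa using hBc, ?_⟩, hW, rfl⟩, ?_, ?_⟩
      · exact fun y hy => (hB' y (by simpa using hy)).1
      · simp only [List.flatten_cons]
        refine (Finset.sort_nodup _ _).append hnd fun y hy hy' => ?_
        exact hA y hy' (Finset.mem_union_right _ (by simpa using hy))
      · simp only [List.flatten_cons, List.mem_append]
        rintro y (hy | hy)
        · exact (hB' y (by simpa using hy)).2
        · exact fun h => hA y hy (Finset.mem_union_left _ h)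
    · rintro ⟨⟨l, W, ⟨hl, hlen, hls⟩, hW, rfl⟩, hnd, hA⟩
      simp only [List.flatten_cons, List.mem_append] at hnd hA
      refine ⟨l.toFinset, ⟨?_, ?_⟩, W, ⟨hW, hnd.of_append_right, ?_⟩, ?_⟩
      · intro y hy
        rw [List.mem_toFinset] at hy
        simpa using ⟨hls y hy, hA y (.inl hy)⟩
      · rw [List.toFinset_card_of_nodup hl.nodup, hlen]
      · intro y hy hy'
        rcases Finset.mem_union.1 hy' with h | h
        · exact hA y (.inr hy) h
        · exact List.disjoint_of_nodup_append hnd (List.mem_toFinset.1 h) hy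
      · rw [sort_toFinset_of_pairwise hl]

theorem card_words (side : X → Bool) (D : List (Bool × ℕ)) (A : Finset X) :
    (words side D A).card =
      numWords D fun b => ((Finset.univ.filter fun y => side y = b) \ A).card := by
  induction D generalizing A with
  | nil => rfl
  | cons d D ih =>
    rw [words, Finset.card_biUnion]
    · rw [numWords, ← Finset.card_powersetCard, ← smul_eq_mul]
      refine Finset.sum_eq_card_nsmul fun B hB => ?_
      rw [Finset.card_image_of_injective _ (List.cons_injective), ih]
      obtain ⟨hB, hBc⟩ := Finset.mem_powersetCard.1 hB
      congr 1
      funext b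
      have e : ∀ F : Finset X, F \ (A ∪ B) = (F \ A) \ B := fun F => by
        ext
        simp only [Finset.mem_sdiff, Finset.mem_union]
        tauto
      rw [e]
      rcases eq_or_ne b (!d.1) with rfl | hb
      · rw [Function.update_self, Finset.card_sdiff_of_subset hB, hBc]
      · rw [Function.update_of_ne hb, Finset.sdiff_eq_self_of_disjoint]
        rw [Finset.disjoint_left]
        intro y hy hy'
        simp only [Finset.mem_sdiff, Finset.mem_filter, Finset.mem_univ, true_and] at hy
        have := hB hy'
        simp only [Finset.mem_sdiff, Finset.mem_filter, Finset.mem_univ, true_and] at this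
        exact hb (hy.1.symm.trans this.1)
    · intro B _ B' _ hne
      rw [Function.onFun, Finset.disjoint_left]
      intro W hW hW'
      obtain ⟨w, -, rfl⟩ := Finset.mem_image.1 hW
      obtain ⟨w', -, e⟩ := Finset.mem_image.1 hW'
      refine hne ?_
      rw [← B.sort_toFinset (· ≤ ·), ← B'.sort_toFinset (· ≤ ·), (List.cons.inj e).1]

/-- Number of ordered pairs of adjacent nodes in a tree. -/
theorem card_edge (s : ℕ) (x : X) (S : LForest X s) (hnd : (labels s x S).Nodup) :
    (Finset.univ.filter fun q : X × X => Edge s x S q.1 q.2).card + 2 =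
      2 * (labels s x S).length := by
  have h₁ := sum_length_nbrs s x none S
  simp only [Option.toList_none, List.length_nil, zero_add] at h₁
  rw [← h₁]
  congr 1
  let L := (nbrs s x none S).flatMap fun q => q.2.map fun z => (q.1, z)
  have hL : L.Nodup := by
    refine List.nodup_flatMap.2 ⟨fun q hq => ?_, ?_⟩
    · exact (nodup_of_mem_nbrs s x none S (by simpa using hnd) hq).map
        fun _ _ h => (Prod.ext_iff.1 h).2
    · rw [← nbrs_map_fst s x none S] at hnd
      refine (List.pairwise_map.1 hnd).imp fun {q q'} hne => ?_
      simp only [Function.onFun, List.disjoint_left, List.mem_map]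
      rintro _ ⟨z, -, rfl⟩ ⟨z', -, e⟩
      exact hne (Prod.ext_iff.1 e).1.symm
  have hlen : L.length = ((nbrs s x none S).map fun q => q.2.length).sum := by
    simp [L, List.length_flatMap]
  rw [← hlen, ← List.toFinset_card_of_nodup hL]
  congr 1
  ext ⟨y, z⟩
  have := exists_mem_nbrs_iff s x none S y z
  simp only [reduceCtorEq, and_false, false_or] at this
  simp only [Finset.mem_filter, Finset.mem_univ, true_and, List.mem_toFinset, L,
    List.mem_flatMap, List.mem_map, Prod.mk.injEq, ← this]
  constructor
  · rintro ⟨q, hq, rfl, hz⟩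
    exact ⟨q, hq, z, hz, rfl, rfl⟩
  · rintro ⟨q, hq, z', hz, rfl, rfl⟩
    exact ⟨q, hq, rfl, hz⟩

end Explore

section Limits

variable {p : ℕ → ℝ} {c : ℝ}

theorem tendsto_natSub_mul {N : ℕ → ℕ} (hp : ∀ n, 0 ≤ p n) (hp₀ : Tendsto p atTop (nhds 0))
    (hN : Tendsto (fun n => (N n : ℝ) * p n) atTop (nhds c)) (k : ℕ) :
    Tendsto (fun n => ((N n - k : ℕ) : ℝ) * p n) atTop (nhds c) := by
  have h : Tendsto (fun n => (N n : ℝ) * p n - k * p n) atTop (nhds c) := by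
    simpa using hN.sub (hp₀.const_mul (k : ℝ))
  refine tendsto_of_tendsto_of_tendsto_of_le_of_le h hN (fun n => ?_) fun n => ?_
  · simp only [← sub_mul]
    exact mul_le_mul_of_nonneg_right (by rw [sub_le_iff_le_add]; exact_mod_cast le_tsub_add)
      (hp n)
  · exact mul_le_mul_of_nonneg_right (Nat.cast_le.2 (Nat.sub_le _ _)) (hp n)

theorem tendsto_choose_mul_pow {N : ℕ → ℕ} (hp : ∀ n, 0 ≤ p n) (hp₀ : Tendsto p atTop (nhds 0))
    (hN : Tendsto (fun n => (N n : ℝ) * p n) atTop (nhds c)) (k : ℕ) :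
    Tendsto (fun n => ((N n).choose k : ℝ) * p n ^ k) atTop (nhds (c ^ k / k.factorial)) := by
  have h : Tendsto (fun n => ((N n).descFactorial k : ℝ) * p n ^ k) atTop (nhds (c ^ k)) := by
    induction k with
    | zero => simp
    | succ k ih =>
      rw [pow_succ']
      refine ((tendsto_natSub_mul hp hp₀ hN k).mul ih).congr fun n => ?_
      rw [Nat.descFactorial_succ]
      push_cast
      ring
  refine (h.div_const _).congr fun n => ?_
  have : (k.factorial : ℝ) ≠ 0 := by positivity
  rw [Nat.descFactorial_eq_factorial_mul_choose]
  push_cast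
  field_simp

theorem tendsto_numWords_mul_pow {r : Bool → ℝ} {N : ℕ → Bool → ℕ} (hp : ∀ n, 0 ≤ p n)
    (hp₀ : Tendsto p atTop (nhds 0))
    (hN : ∀ b, Tendsto (fun n => (N n b : ℝ) * p n) atTop (nhds (r b))) (D : List (Bool × ℕ)) :
    Tendsto (fun n => (numWords D (N n) : ℝ) * p n ^ (D.map Prod.snd).sum) atTop
      (nhds (D.map fun d => r (!d.1) ^ d.2 / d.2.factorial).prod) := by
  induction D generalizing N with
  | nil => simp [numWords]
  | cons d D ih =>
    have hN' : ∀ b, Tendsto (fun n => (Function.update (N n) (!d.1) (N n (!d.1) - d.2) b : ℝ)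
        * p n) atTop (nhds (r b)) := by
      intro b
      rcases eq_or_ne b (!d.1) with rfl | hb
      · simpa using tendsto_natSub_mul hp hp₀ (hN _) d.2
      · simpa [Function.update_of_ne hb] using hN b
    rw [List.map_cons (l := D) (f := fun d => r (!d.1) ^ d.2 / _), List.prod_cons]
    refine ((tendsto_choose_mul_pow hp hp₀ (hN (!d.1)) d.2).mul (ih hN')).congr fun n => ?_
    rw [numWords, List.map_cons, List.sum_cons, pow_add]
    push_cast
    ring

theorem tendsto_one_sub_pow {M : ℕ → ℕ} (hp₀ : Tendsto p atTop (nhds 0))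
    (hM : Tendsto (fun n => (M n : ℝ) * p n) atTop (nhds c)) :
    Tendsto (fun n => (1 - p n) ^ M n) atTop (nhds (Real.exp (-c))) := by
  have hd : Tendsto (fun x : ℝ => dslope (fun y => Real.log (1 - y)) 0 x) (nhds 0)
      (nhds (-1)) := by
    have hder : HasDerivAt (fun y : ℝ => Real.log (1 - y)) (-1) 0 := by
      simpa using ((hasDerivAt_id (0 : ℝ)).const_sub 1).log (by simp)
    have := (continuousAt_dslope_same.2 hder.differentiableAt).tendsto
    rwa [dslope_same, hder.deriv] at this
  have hlog : ∀ x : ℝ, Real.log (1 - x) = x * dslope (fun y => Real.log (1 - y)) 0 x := by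
    intro x
    simpa using (sub_smul_dslope (fun y => Real.log (1 - y)) 0 x).symm
  have h := hM.mul (hd.comp hp₀)
  rw [mul_neg_one] at h
  refine ((Real.continuous_exp.tendsto _).comp h).congr' ?_
  filter_upwards [hp₀.eventually (gt_mem_nhds one_pos)] with n hn
  have : 0 < 1 - p n := sub_pos.2 hn
  simp only [Function.comp_apply]
  rw [mul_assoc, ← hlog, mul_comm, Real.exp_mul, Real.exp_log this, Real.rpow_natCast]

end Limits

section Cylinder

variable {V F : Type*} [Fintype V] [Fintype F] [DecidableEq V] [DecidableEq F]

theorem sum_prod_prod_eq (f : V → F → Bool → ℝ) :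
    ∑ g : V → F → Bool, ∏ i, ∏ a, f i a (g i a) = ∏ i, ∏ a, ∑ b, f i a b := by
  rw [← Fintype.piFinset_univ, ← Finset.prod_univ_sum (fun _ => univ)
    fun i (x : F → Bool) => ∏ a, f i a (x a)]
  refine Finset.prod_congr rfl fun i _ => ?_
  rw [← Fintype.piFinset_univ, ← Finset.prod_univ_sum]

theorem expG_cylinder (p : ℝ) (C h : V → F → Prop) (hC : ∀ i a, h i a → C i a)
    [∀ g : V → F → Bool, Decidable (∀ i a, C i a → (g i a = true ↔ h i a))] :
    expG p (fun g => if ∀ i a, C i a → (g i a = true ↔ h i a) then 1 else 0) =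
      p ^ (univ.filter fun q : V × F => h q.1 q.2).card *
        (1 - p) ^ (univ.filter fun q : V × F => C q.1 q.2 ∧ ¬ h q.1 q.2).card := by
  have e : ∀ g : V → F → Bool,
      gW p g * (if ∀ i a, C i a → (g i a = true ↔ h i a) then 1 else 0) =
        ∏ i, ∏ a, ((if g i a then p else 1 - p) *
          if C i a → (g i a = true ↔ h i a) then 1 else 0) := by
    intro g
    simp only [gW, Finset.prod_mul_distrib, Finset.prod_ite_zero, Finset.mem_univ, true_imp_iff,
      Finset.prod_const_one]
  rw [expG, Finset.sum_congr rfl fun g _ => e g,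
    sum_prod_prod_eq fun i a b => (if b then p else 1 - p) *
      if C i a → (b = true ↔ h i a) then 1 else 0]
  have e' : ∀ i a, ∑ b, ((if b then p else 1 - p) *
      if C i a → (b = true ↔ h i a) then 1 else 0) =
      (if h i a then p else 1) * if C i a ∧ ¬ h i a then 1 - p else 1 := by
    intro i a
    have := hC i a
    by_cases h₁ : h i a <;> by_cases h₂ : C i a <;> simp_all
  simp only [e']
  rw [← Fintype.prod_prod_type' fun i a => (if h i a then p else 1) *
    if C i a ∧ ¬ h i a then 1 - p else 1]
  simp only [Finset.prod_mul_distrib, Finset.prod_ite,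
    Finset.prod_const_one, mul_one, Finset.prod_const]

theorem expG_sum {ι : Type*} (p : ℝ) (s : Finset ι) (f : ι → (V → F → Bool) → ℝ) :
    expG p (fun g => ∑ x ∈ s, f x g) = ∑ x ∈ s, expG p (f x) := by
  simp only [expG, Finset.mul_sum]
  exact Finset.sum_comm

theorem card_cross (A : Finset V) (B : Finset F) :
    (univ.filter fun q : V × F => q.1 ∈ A ∨ q.2 ∈ B).card =
      A.card * Fintype.card F + Fintype.card V * B.card - A.card * B.card := by
  have h : (univ.filter fun q : V × F => q.1 ∈ A ∨ q.2 ∈ B) = A ×ˢ univ ∪ univ ×ˢ B := by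
    ext
    simp
  have h' : (A ×ˢ univ) ∩ (univ ×ˢ B) = A ×ˢ B := by
    ext
    simp
  rw [h, Finset.card_union, h']
  simp [Finset.card_product]

end Cylinder

section Bipartite

open LForest

variable {n m : ℕ}

/-- The side of a node: `false` for variable nodes, `true` for function nodes. -/
def side (x : Fin n ⊕ₗ Fin m) : Bool := (ofLex x).isRight

/-- Adjacency in the bipartite graph `g`. -/
def adj (g : Fin n → Fin m → Bool) (x y : Fin n ⊕ₗ Fin m) : Prop :=
  match ofLex x, ofLex y with
  | .inl i, .inr a => g i a = true
  | .inr a, .inl i => g i a = true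
  | _, _ => False

variable (g : Fin n → Fin m → Bool)

@[simp] theorem side_inl (i : Fin n) : side (Sum.inlₗ i : Fin n ⊕ₗ Fin m) = false := rfl

@[simp] theorem side_inr (a : Fin m) : side (Sum.inrₗ a : Fin n ⊕ₗ Fin m) = true := rfl

@[simp] theorem adj_inl_inr (i : Fin n) (a : Fin m) :
    adj g (Sum.inlₗ i) (Sum.inrₗ a) ↔ g i a = true := Iff.rfl

@[simp] theorem adj_inr_inl (i : Fin n) (a : Fin m) :
    adj g (Sum.inrₗ a) (Sum.inlₗ i) ↔ g i a = true := Iff.rfl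

@[simp] theorem adj_inl_inl (i j : Fin n) :
    ¬ adj g (Sum.inlₗ i) (Sum.inlₗ j) := id

@[simp] theorem adj_inr_inr (a b : Fin m) :
    ¬ adj g (Sum.inrₗ a) (Sum.inrₗ b) := id

theorem forall_lex {P : Fin n ⊕ₗ Fin m → Prop} :
    (∀ x, P x) ↔ (∀ i, P (Sum.inlₗ i)) ∧ ∀ a, P (Sum.inrₗ a) :=
  Sum.forall

theorem inl_injective : Function.Injective (Sum.inlₗ : Fin n → Fin n ⊕ₗ Fin m) :=
  Sum.inl_injective

theorem inr_injective : Function.Injective (Sum.inrₗ : Fin m → Fin n ⊕ₗ Fin m) :=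
  Sum.inr_injective

theorem inl_ne_inr (i : Fin n) (a : Fin m) : (Sum.inlₗ i : Fin n ⊕ₗ Fin m) ≠ Sum.inrₗ a :=
  Sum.inl_ne_inr

theorem adj_symm : ∀ x y, adj g x y → adj g y x := by
  simp

theorem side_of_adj : ∀ x y, adj g x y → side y = !side x := by
  simp

theorem children_inl (i : Fin n) (pa : Option (Fin m)) :
    children (adj g) (Sum.inlₗ i) (pa.map Sum.inrₗ) = (funCh g i pa).map Sum.inrₗ := by
  refine children_eq_of_mem_iff ?_ ?_
  · exact (pairwise_lt_sort _).map _ fun a b h => Sum.Lex.inr_strictMono h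
  · have e : ∀ a, some (Sum.inrₗ a : Fin n ⊕ₗ Fin m) = pa.map Sum.inrₗ ↔ some a = pa :=
      fun a => (Option.map_injective inr_injective).eq_iff (a := some a)
    rw [forall_lex]
    constructor
    · simp [(inl_ne_inr _ _).symm]
    · simp [funCh, e, inr_injective.eq_iff]

theorem children_inr (a : Fin m) (i : Fin n) :
    children (adj g) (Sum.inrₗ a) (some (Sum.inlₗ i)) = (varCh g a i).map Sum.inlₗ := by
  refine children_eq_of_mem_iff ?_ ?_
  · exact (pairwise_lt_sort _).map _ fun a b h => Sum.Lex.inl_strictMono h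
  · rw [forall_lex]
    constructor
    · simp [varCh, inl_injective.eq_iff]
    · simp

/-- The rooted tree with a given shape of even depth. -/
def toB : (t : ℕ) → Shape (2 * t) → BTree
  | 0, _ => BTree.node []
  | t + 1, T => BTree.node <|
      (Shape.kids (s := 2 * t + 1) T).map fun U => (Shape.kids (s := 2 * t) U).map (toB t)

theorem kids_explore {X : Type} [LinearOrder X] [Fintype X] (G : X → X → Prop) (s : ℕ) (x : X)
    (pa : Option X) : (explore G (s + 1) x pa).kids =
      (children G x pa).map fun y => (y, explore G s y (some x)) := rfl

theorem kids_shape {X : Type} (s : ℕ) (S : LForest X (s + 1)) :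
    (shape (s + 1) S).kids = S.kids.map fun c => shape s c.2 := rfl

theorem exploreV_eq (t : ℕ) (i : Fin n) (pa : Option (Fin m)) :
    exploreV g t i pa =
      toB t (shape (2 * t) (explore (adj g) (2 * t) (Sum.inlₗ i) (pa.map Sum.inrₗ))) := by
  induction t generalizing i pa with
  | zero => rfl
  | succ t ih =>
    have ih' := fun a j => ih j (some a)
    simp only [Option.map_some] at ih'
    simp only [exploreV, toB]
    erw [kids_shape, kids_explore, children_inl]
    simp only [List.map_map, Function.comp_def, kids_shape, kids_explore, children_inr, ih']

theorem labels_explore_succ (t : ℕ) (i : Fin n) (pa : Option (Fin m)) :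
    labels (2 * (t + 1)) (Sum.inlₗ i)
        (explore (adj g) (2 * (t + 1)) (Sum.inlₗ i) (pa.map Sum.inrₗ)) =
      Sum.inlₗ i :: ((funCh g i pa).flatMap fun a => Sum.inrₗ a ::
        ((varCh g a i).flatMap fun j => labels (2 * t) (Sum.inlₗ j)
          (explore (adj g) (2 * t) (Sum.inlₗ j) ((some a).map Sum.inrₗ)))) := by
  change labels (2 * t + 1 + 1) _ _ = _
  simp only [labels]
  erw [kids_explore, children_inl]
  simp only [List.flatMap_map, kids_explore, children_inr]
  rfl

theorem visitedV_eq (t : ℕ) (i : Fin n) (pa : Option (Fin m)) :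
    visitedV g t i pa = (labels (2 * t) (Sum.inlₗ i)
      (explore (adj g) (2 * t) (Sum.inlₗ i) (pa.map Sum.inrₗ))).filterMap
        fun x => (ofLex x).getLeft? := by
  induction t generalizing i pa with
  | zero => rfl
  | succ t ih =>
    rw [labels_explore_succ]
    simp [visitedV, ih, List.filterMap_cons, List.flatMap_def, Function.comp_def]

theorem visitedF_eq (t : ℕ) (i : Fin n) (pa : Option (Fin m)) :
    visitedF g t i pa = (labels (2 * t) (Sum.inlₗ i)
      (explore (adj g) (2 * t) (Sum.inlₗ i) (pa.map Sum.inrₗ))).filterMap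
        fun x => (ofLex x).getRight? := by
  induction t generalizing i pa with
  | zero => rfl
  | succ t ih =>
    rw [labels_explore_succ]
    simp [visitedF, ih, List.filterMap_cons, List.flatMap_def, Function.comp_def]

theorem nodup_iff_filterMap (l : List (Fin n ⊕ₗ Fin m)) :
    l.Nodup ↔ (l.filterMap fun x => (ofLex x).getLeft?).Nodup ∧
      (l.filterMap fun x => (ofLex x).getRight?).Nodup := by
  induction l with
  | nil => simp
  | cons x l ih =>
    revert x
    rw [forall_lex]
    constructor
    · intro i
      simp [ih, List.filterMap_cons, and_assoc]
    · intro a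
      simp [ih, List.filterMap_cons, and_left_comm]

theorem nodup_visited_iff (t : ℕ) (i : Fin n) :
    (visitedV g t i none).Nodup ∧ (visitedF g t i none).Nodup ↔
      (labels (2 * t) (Sum.inlₗ i) (explore (adj g) (2 * t) (Sum.inlₗ i) none)).Nodup := by
  rw [nodup_iff_filterMap, visitedV_eq, visitedF_eq]
  rfl

theorem gwW_toB (γ α : ℝ) (t : ℕ) (T : Shape (2 * t)) :
    gwW γ α t (toB t T) = ((T.degs false (2 * t)).map fun d =>
      poissonReal (if d.1 then γ else γ * α) d.2).prod := by
  induction t with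
  | zero => simp [toB, gwW, Shape.degs]
  | succ t ih =>
    change _ = ((Shape.degs false (2 * t + 1 + 1) T).map _).prod
    simp only [toB, gwW, Shape.degs, List.map_map, List.length_map, Function.comp_def, ih,
      List.map_cons, List.prod_cons, List.flatMap_def, List.map_flatten, List.prod_flatten,
      Bool.not_false, Bool.not_true, if_true, Bool.false_eq_true, if_false]

theorem toB_injective (t : ℕ) : Function.Injective (toB t) := by
  induction t with
  | zero => exact fun _ _ _ => rfl
  | succ t ih =>
    intro T T' h
    simp only [toB, BTree.node.injEq] at h
    exact List.map_injective_iff.2 (List.map_injective_iff.2 ih) h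

end Bipartite

section Probability

open LForest

variable {n m : ℕ}

theorem explore_adj_eq_iff (g : Fin n → Fin m → Bool) (s : ℕ) (x : Fin n ⊕ₗ Fin m)
    (S : LForest (Fin n ⊕ₗ Fin m) s) (hS : ∀ l ∈ blocks s S, l.Pairwise (· < ·))
    (hnd : (labels s x S).Nodup) (hs : Sided side s x S) :
    explore (adj g) s x none = S ↔
      ∀ i a, Sum.inlₗ i ∈ internal s x S ∨ Sum.inrₗ a ∈ internal s x S →
        (g i a = true ↔ Edge s x S (Sum.inlₗ i) (Sum.inrₗ a)) := by
  rw [explore_eq_iff (adj_symm g) s x none S hS (by simpa using hnd) (by simp)]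
  have e : (∀ q ∈ innerNbrs s x none S, ∀ z, adj g q.1 z ↔ z ∈ q.2) ↔
      ∀ y ∈ internal s x S, ∀ z, adj g y z ↔ Edge s x S y z := by
    simp only [← innerNbrs_map_fst s x none S, List.mem_map, forall_exists_index, and_imp,
      forall_apply_eq_imp_iff₂]
    refine forall₂_congr fun q hq => forall_congr' fun z => ?_
    rw [mem_nbrs_iff_edge hnd ((innerNbrs_sublist s x none S).subset hq)]
  have hll : ∀ i j, ¬ Edge s x S (Sum.inlₗ i) (Sum.inlₗ j) := fun i j h => by
    simpa using edge_side s x S hs h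
  have hrr : ∀ a b, ¬ Edge s x S (Sum.inrₗ a) (Sum.inrₗ b) := fun a b h => by
    simpa using edge_side s x S hs h
  have hsymm : ∀ i a, Edge s x S (Sum.inrₗ a) (Sum.inlₗ i) ↔
    Edge s x S (Sum.inlₗ i) (Sum.inrₗ a) := fun i a => ⟨edge_symm s x S, edge_symm s x S⟩
  rw [e]
  simp only [forall_lex, adj_inl_inl, adj_inl_inr, adj_inr_inl, adj_inr_inr, hll, hrr, hsymm]
  constructor
  · rintro ⟨h₁, h₂⟩ i a (hi | ha)
    · exact (h₁ i hi).2 a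
    · exact (h₂ a ha).1 i
  · intro h
    exact ⟨fun i hi => ⟨fun _ => trivial, fun a => h i a (.inl hi)⟩,
      fun a ha => ⟨fun i => h i a (.inr ha), fun _ => trivial⟩⟩

theorem card_edge_inl_inr (s : ℕ) (x : Fin n ⊕ₗ Fin m) (S : LForest (Fin n ⊕ₗ Fin m) s)
    (hnd : (labels s x S).Nodup) (hs : Sided side s x S) :
    (univ.filter fun q : Fin n × Fin m => Edge s x S (Sum.inlₗ q.1) (Sum.inrₗ q.2)).card + 1 =
      (labels s x S).length := by
  set E := univ.filter fun q : Fin n × Fin m => Edge s x S (Sum.inlₗ q.1) (Sum.inrₗ q.2) with hE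
  have h := card_edge s x S hnd
  let f : Fin n × Fin m ↪ (Fin n ⊕ₗ Fin m) × (Fin n ⊕ₗ Fin m) :=
    ⟨fun q => (Sum.inlₗ q.1, Sum.inrₗ q.2), fun q q' e => Prod.ext
      (inl_injective (Prod.ext_iff.1 e).1) (inr_injective (Prod.ext_iff.1 e).2)⟩
  have hdisj : Disjoint (E.map f) (E.map (f.trans (Equiv.prodComm _ _).toEmbedding)) := by
    simp only [Finset.disjoint_left, Finset.mem_map]
    rintro _ ⟨q, -, rfl⟩ ⟨q', -, e⟩
    exact inl_ne_inr _ _ (Prod.ext_iff.1 e).1.symm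
  have e : (univ.filter fun q : (Fin n ⊕ₗ Fin m) × (Fin n ⊕ₗ Fin m) => Edge s x S q.1 q.2) =
      (E.map f).disjUnion _ hdisj := by
    ext ⟨y, z⟩
    simp only [Finset.mem_filter, Finset.mem_univ, true_and, Finset.mem_disjUnion,
      Finset.mem_map, hE]
    constructor
    · intro h
      have hyz := edge_side s x S hs h
      revert y z
      simp only [forall_lex]
      refine ⟨fun i => ⟨fun j _ h => by simp at h, fun a h _ => .inl ⟨(i, a), h, rfl⟩⟩,
        fun a => ⟨fun i h _ => .inr ⟨(i, a), edge_symm s x S h, rfl⟩, fun b _ h => by simp at h⟩⟩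
    · rintro (⟨q, h, e⟩ | ⟨q, h, e⟩)
      · obtain ⟨rfl, rfl⟩ := Prod.ext_iff.1 e
        exact h
      · obtain ⟨rfl, rfl⟩ := Prod.ext_iff.1 e
        exact edge_symm s x S h
  rw [e, Finset.card_disjUnion, Finset.card_map, Finset.card_map] at h
  omega

theorem card_internal (s : ℕ) (x : Fin n ⊕ₗ Fin m) (S : LForest (Fin n ⊕ₗ Fin m) s)
    (hnd : (labels s x S).Nodup) (hs : Sided side s x S) (b : Bool) :
    (univ.filter fun y => y ∈ internal s x S ∧ side y = b).card =
      (((shape s S).degs (side x) s).map Prod.fst).count b := by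
  rw [← internal_map_side s x S hs, List.count, List.countP_map, List.countP_eq_length_filter,
    ← List.toFinset_card_of_nodup ((hnd.sublist (internal_sublist s x S)).filter _)]
  congr 1
  ext y
  simp

/-- The probability of an exploration history depends only on the degrees of the explored
nodes: an edge for every non-root node, and no edge for the remaining pairs with an internal
node. -/
theorem expG_explore_eq (p : ℝ) (s : ℕ) (x : Fin n ⊕ₗ Fin m) (S : LForest (Fin n ⊕ₗ Fin m) s)
    (hS : ∀ l ∈ blocks s S, l.Pairwise (· < ·)) (hnd : (labels s x S).Nodup)
    (hs : Sided side s x S) {D : List (Bool × ℕ)} (hD : (shape s S).degs (side x) s = D) :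
    expG p (fun g : Fin n → Fin m → Bool =>
        if explore (adj g) s x none = S then 1 else 0) =
      p ^ (D.map Prod.snd).sum *
        (1 - p) ^ ((D.map Prod.fst).count false * m + n * (D.map Prod.fst).count true -
          (D.map Prod.fst).count false * (D.map Prod.fst).count true - (D.map Prod.snd).sum) := by
  obtain ⟨C, hC⟩ : ∃ C : Fin n → Fin m → Prop, ∀ i a, C i a ↔
      Sum.inlₗ i ∈ internal s x S ∨ Sum.inrₗ a ∈ internal s x S := ⟨_, fun _ _ => Iff.rfl⟩
  have hC' : ∀ i a, Edge s x S (Sum.inlₗ i) (Sum.inrₗ a) → C i a :=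
    fun i a h => (hC i a).2 (edge_internal s x S h)
  have he := fun g => explore_adj_eq_iff g s x S hS hnd hs
  simp only [← hC] at he
  refine (congrArg (expG p) (funext fun g => if_congr (he g) rfl rfl)).trans
    ((expG_cylinder p _ _ hC').trans ?_)
  have hE : (univ.filter fun q : Fin n × Fin m =>
      Edge s x S (Sum.inlₗ q.1) (Sum.inrₗ q.2)).card = (D.map Prod.snd).sum := by
    have h₁ := card_edge_inl_inr s x S hnd hs
    have h₂ := (labels_perm s x S).length_eq
    rw [List.length_cons, List.length_flatten, ← shape_degs_eq (side x), hD] at h₂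
    omega
  have hV : (univ.filter fun i : Fin n => (Sum.inlₗ i : Fin n ⊕ₗ Fin m) ∈ internal s x S).card =
      (D.map Prod.fst).count false := by
    rw [← hD, ← card_internal s x S hnd hs, ← Finset.card_map ⟨_, inl_injective⟩]
    congr 1
    ext y
    revert y
    simp
  have hF : (univ.filter fun a : Fin m => (Sum.inrₗ a : Fin n ⊕ₗ Fin m) ∈ internal s x S).card =
      (D.map Prod.fst).count true := by
    rw [← hD, ← card_internal s x S hnd hs, ← Finset.card_map ⟨_, inr_injective⟩]
    congr 1
    ext y
    revert y
    simp
  have hVF : (univ.filter fun q : Fin n × Fin m => C q.1 q.2).card = (D.map Prod.fst).count false * m +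
        n * (D.map Prod.fst).count true -
          (D.map Prod.fst).count false * (D.map Prod.fst).count true := by
    have h := card_cross
      (univ.filter fun i : Fin n => (Sum.inlₗ i : Fin n ⊕ₗ Fin m) ∈ internal s x S)
      (univ.filter fun a : Fin m => (Sum.inrₗ a : Fin n ⊕ₗ Fin m) ∈ internal s x S)
    rw [hV, hF, Fintype.card_fin, Fintype.card_fin] at h
    rw [← h]
    congr 1
    ext
    simp [hC]
  rw [Finset.filter_and_not, Finset.card_sdiff_of_subset, hE, hVF]
  exact Finset.monotone_filter_right _ fun q _ h => hC' _ _ h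

theorem card_side_sdiff (i : Fin n) (b : Bool) :
    ((univ.filter fun y : Fin n ⊕ₗ Fin m => side y = b) \ {Sum.inlₗ i}).card =
      if b then m else n - 1 := by
  cases b
  · have e : (univ.filter fun y : Fin n ⊕ₗ Fin m => side y = false) \ {Sum.inlₗ i} =
        (univ.erase i).map ⟨_, inl_injective⟩ := by
      ext y
      revert y
      simp
    simp [e]
  · have e : (univ.filter fun y : Fin n ⊕ₗ Fin m => side y = true) \ {Sum.inlₗ i} =
        univ.map ⟨_, inr_injective⟩ := by
      ext y
      revert y
      simp
    simp [e]

theorem expG_shape_eq (p : ℝ) (s : ℕ) (i : Fin n) (R : Shape s) {D : List (Bool × ℕ)}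
    (hD : R.degs false s = D) :
    expG p (fun g : Fin n → Fin m → Bool =>
        if (labels s (Sum.inlₗ i) (explore (adj g) s (Sum.inlₗ i) none)).Nodup ∧
          shape s (explore (adj g) s (Sum.inlₗ i) none) = R then 1 else 0) =
      numWords D (fun b => if b then m else n - 1) * (p ^ (D.map Prod.snd).sum *
        (1 - p) ^ ((D.map Prod.fst).count false * m + n * (D.map Prod.fst).count true -
          (D.map Prod.fst).count false * (D.map Prod.fst).count true -
            (D.map Prod.snd).sum)) := by
  set x : Fin n ⊕ₗ Fin m := Sum.inlₗ i with hx
  have hnodup : ∀ S : LForest (Fin n ⊕ₗ Fin m) s, (labels s x S).Nodup ↔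
      (blocks s S).flatten.Nodup ∧ ∀ y ∈ (blocks s S).flatten, y ∉ ({x} : Finset _) := by
    intro S
    rw [(labels_perm s x S).nodup_iff, List.nodup_cons, and_comm]
    simp only [Finset.mem_singleton]
    exact and_congr_right fun _ => ⟨fun h y hy e => h (e ▸ hy), fun h hx => h x hx rfl⟩
  have hsum : ∀ g : Fin n → Fin m → Bool,
      (if (labels s x (explore (adj g) s x none)).Nodup ∧
        shape s (explore (adj g) s x none) = R then 1 else 0 : ℝ) =
      ∑ W ∈ words side D {x}, if shape s (explore (adj g) s x none) = R ∧
        blocks s (explore (adj g) s x none) = W then 1 else 0 := by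
    intro g
    by_cases hR : shape s (explore (adj g) s x none) = R
    · have := forall₂_blocks_explore (side := side) (side_of_adj g) s x none
      rw [hR, hx, side_inl, hD, ← hx] at this
      simp only [hR, and_true, true_and, Finset.sum_ite_eq, mem_words, hnodup, this]
    · simp [hR]
  rw [funext hsum, expG_sum]
  have hcard : (words side D {x}).card = numWords D fun b => if b then m else n - 1 := by
    rw [card_words]
    congr 1
    funext b
    rw [← card_side_sdiff i b]
    congr!
  rw [← hcard, ← nsmul_eq_mul]
  refine Finset.sum_eq_card_nsmul fun W hW => ?_
  rw [mem_words] at hW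
  obtain ⟨hW, hW'⟩ := hW
  have hlen : W.map List.length = (R.degs false s).map Prod.snd := by
    rw [hD]
    clear hsum hcard hW' hD
    induction hW with
    | nil => rfl
    | cons h _ ih => simp [h.2.1, ih]
  have hsort : ∀ l ∈ W, l.Pairwise (· < ·) := by
    clear hsum hcard hW' hD hlen
    induction hW with
    | nil => simp
    | cons h _ ih => exact List.forall_mem_cons.2 ⟨h.1, ih⟩
  obtain ⟨S, rfl, rfl⟩ := exists_forest_of_lengths s R W hlen
  have e : ∀ g : Fin n → Fin m → Bool, (shape s (explore (adj g) s x none) = shape s S ∧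
      blocks s (explore (adj g) s x none) = blocks s S) ↔ explore (adj g) s x none = S :=
    fun g => ⟨fun h => forest_ext s _ _ h.1 h.2, fun h => by simp [h]⟩
  simp only [e]
  exact expG_explore_eq p s x S hsort ((hnodup S).2 hW') (sided_of_forall₂ s x S (hD ▸ hW)) hD

end Probability

section LocalConvergence

open LForest

theorem prod_poissonReal (r : Bool → ℝ) (D : List (Bool × ℕ)) :
    (D.map fun d => poissonReal (r (!d.1)) d.2).prod =
      (D.map fun d => r (!d.1) ^ d.2 / d.2.factorial).prod *
        Real.exp (-((D.map Prod.fst).count false * r true +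
          (D.map Prod.fst).count true * r false)) := by
  induction D with
  | nil => simp
  | cons d D ih =>
    obtain ⟨b, k⟩ := d
    simp only [List.map_cons, List.prod_cons, ih]
    rw [poissonReal]
    cases b
    · simp only [List.count_cons_self, List.count_cons_of_ne, ne_eq, Bool.false_eq_true,
        not_false_eq_true, Bool.not_false]
      push_cast
      rw [add_one_mul, add_right_comm, neg_add _ (r true), Real.exp_add]
      ring
    · simp only [List.count_cons_self, List.count_cons_of_ne, ne_eq, Bool.true_eq_false,
        not_false_eq_true, Bool.not_true]
      push_cast
      rw [add_one_mul, ← add_assoc, neg_add _ (r false), Real.exp_add]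
      ring

theorem tendsto_expG_shape {α γ : ℝ} (hα : 0 < α) (hγ : 0 < γ) (t : ℕ) (R : Shape (2 * t)) :
    Tendsto (fun n : ℕ => expG (γ / (n + 1))
      (fun g : Fin (n + 1) → Fin (Nat.floor (α * (n + 1))) → Bool =>
        if (labels (2 * t) (Sum.inlₗ 0)
            (explore (adj g) (2 * t) (Sum.inlₗ 0) none)).Nodup ∧
          shape (2 * t) (explore (adj g) (2 * t) (Sum.inlₗ 0) none) = R then 1 else 0))
      atTop (nhds (gwW γ α t (toB t R))) := by
  set D := R.degs false (2 * t) with hD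
  let p : ℕ → ℝ := fun n => γ / (n + 1)
  let N : ℕ → Bool → ℕ := fun n b => if b then Nat.floor (α * (n + 1)) else n + 1 - 1
  let r : Bool → ℝ := fun b => if b then γ * α else γ
  have hn : Tendsto (fun n : ℕ => (n : ℝ) + 1) atTop atTop :=
    tendsto_atTop_add_const_right _ _ tendsto_natCast_atTop_atTop
  have hpos : ∀ n : ℕ, (0 : ℝ) < n + 1 := fun n => by positivity
  have hp : ∀ n, 0 ≤ p n := fun n => by positivity
  have hp₀ : Tendsto p atTop (nhds 0) := hn.const_div_atTop γ
  have hm : Tendsto (fun n : ℕ => (Nat.floor (α * (n + 1)) : ℝ) * p n) atTop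
      (nhds (γ * α)) := by
    have := ((tendsto_nat_floor_mul_div_atTop hα.le).comp hn).const_mul γ
    refine this.congr fun n => ?_
    simp only [Function.comp_apply, p]
    ring
  have hn' : Tendsto (fun n : ℕ => ((n + 1 : ℕ) : ℝ) * p n) atTop (nhds γ) := by
    refine tendsto_const_nhds.congr fun n => ?_
    have := (hpos n).ne'
    simp only [p]
    push_cast
    field_simp
  have hN : ∀ b, Tendsto (fun n => (N n b : ℝ) * p n) atTop (nhds (r b)) := by
    rintro (_ | _)
    · exact tendsto_natSub_mul hp hp₀ hn' 1
    · exact hm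
  have hM : Tendsto (fun n : ℕ => (((D.map Prod.fst).count false * Nat.floor (α * (n + 1)) +
      (n + 1) * (D.map Prod.fst).count true : ℕ) : ℝ) * p n) atTop
      (nhds ((D.map Prod.fst).count false * r true + (D.map Prod.fst).count true * r false)) := by
    refine ((hm.const_mul ((D.map Prod.fst).count false : ℝ)).add
      (hn'.const_mul ((D.map Prod.fst).count true : ℝ))).congr fun n => ?_
    push_cast
    ring
  have hgw : gwW γ α t (toB t R) = (D.map fun d => poissonReal (r (!d.1)) d.2).prod := by
    rw [gwW_toB]
    congr 2
    funext d
    cases d.1 <;> rfl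
  rw [hgw, prod_poissonReal]
  refine ((tendsto_numWords_mul_pow hp hp₀ hN D).mul (tendsto_one_sub_pow hp₀
    (tendsto_natSub_mul hp hp₀ (tendsto_natSub_mul hp hp₀ hM
      ((D.map Prod.fst).count false * (D.map Prod.fst).count true))
        (D.map Prod.snd).sum))).congr fun n => ?_
  rw [expG_shape_eq _ _ _ _ hD.symm, mul_assoc]

theorem finite_setOf_forall₂ {β : Type*} {r : β → β → Prop} (hr : ∀ b, {a | r a b}.Finite)
    (l' : List β) : {l | List.Forall₂ r l l'}.Finite := by
  induction l' with
  | nil => simp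
  | cons b l' ih =>
    refine (Set.Finite.image2 List.cons (hr b) ih).subset ?_
    intro l hl
    obtain ⟨a, l, h, h', rfl⟩ := List.forall₂_cons_right_iff.1 hl
    exact ⟨a, h, l, h', rfl⟩

theorem finite_setOf_listPermRel {β : Type*} {r : β → β → Prop} (hr : ∀ b, {a | r a b}.Finite)
    (l' : List β) : {l | listPermRel r l l'}.Finite := by
  refine ((List.finite_toSet l'.permutations).biUnion fun l₂ _ =>
    finite_setOf_forall₂ hr l₂).subset ?_
  rintro l ⟨l₂, h, h'⟩
  exact Set.mem_biUnion (List.mem_permutations.2 h) h'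

theorem listPermRel_exists {β : Type*} {r : β → β → Prop} {l l' : List β}
    (h : listPermRel r l l') {a : β} (ha : a ∈ l) : ∃ b, r a b := by
  obtain ⟨l₂, -, h⟩ := h
  induction h with
  | nil => simp at ha
  | cons h _ ih =>
    rcases List.mem_cons.1 ha with rfl | ha
    · exact ⟨_, h⟩
    · exact ih ha

theorem finite_setOf_varEquiv (t : ℕ) (T' : BTree) : {T | varEquiv t T T'}.Finite := by
  induction t generalizing T' with
  | zero => exact (Set.finite_singleton (BTree.node [])).subset fun T h => h.1
  | succ t ih =>
    obtain ⟨cs'⟩ := T'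
    refine ((finite_setOf_listPermRel (finite_setOf_listPermRel ih) cs').image
      BTree.node).subset ?_
    rintro ⟨cs⟩ h
    exact ⟨cs, h, rfl⟩

theorem exists_toB_eq {t : ℕ} {T T' : BTree} (h : varEquiv t T T') : ∃ R, toB t R = T := by
  induction t generalizing T T' with
  | zero => exact ⟨(), h.1.symm⟩
  | succ t ih =>
    obtain ⟨cs⟩ := T
    obtain ⟨cs'⟩ := T'
    have hf : ∀ f ∈ cs, f ∈ Set.range (List.map (toB t)) := by
      intro f hf
      obtain ⟨f', h'⟩ := listPermRel_exists h hf
      rw [Set.range_list_map]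
      intro T hT
      obtain ⟨T', h''⟩ := listPermRel_exists h' hT
      exact ih h''
    have hcs : cs ∈ Set.range (List.map (List.map (toB t))) := by
      rw [Set.range_list_map]
      exact hf
    obtain ⟨R, rfl⟩ := hcs
    exact ⟨R, rfl⟩

end LocalConvergence

/-- Proposition 4.1 of the paper: local convergence of the neighbourhood
of a fixed variable node to the Galton–Watson tree.  For a random bipartite graph from
`𝒢(n, αn, γ/n)` and any fixed rooted tree `T_*`,
`lim_{n→∞} P{𝖡(i,t) ≃ T_*} = P{𝖳(t) ≃ T_*}`.
The event `𝖡(i,t) ≃ T_*` is: the radius-`t` exploration from `i` visits pairwise distinct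
nodes (i.e. `𝖡(i,t)` is a tree) and the explored tree is isomorphic to `T_*`; the
Galton–Watson probability is the sum of the weights of all ordered trees isomorphic
to `T_*`. -/
theorem statement_8 (α γ : ℝ) (hα : 0 < α) (hγ : 0 < γ) (t : ℕ) (Tstar : BTree) :
    Filter.Tendsto
      (fun n : ℕ =>
        expG (γ / (n + 1))
          (fun g : Fin (n + 1) → Fin (Nat.floor (α * (n + 1))) → Bool =>
            if (visitedV g t 0 none).Nodup ∧ (visitedF g t 0 none).Nodup ∧
                varEquiv t (exploreV g t 0 none) Tstar then 1 else 0))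
      Filter.atTop
      (nhds (∑' T : BTree, if varEquiv t T Tstar then gwW γ α t T else 0)) := by
  have hfin : {R : Shape (2 * t) | varEquiv t (toB t R) Tstar}.Finite :=
    (finite_setOf_varEquiv t Tstar).preimage (toB_injective t).injOn
  have hmem : ∀ R, R ∈ hfin.toFinset ↔ varEquiv t (toB t R) Tstar := fun R => by simp
  have hlim : (∑' T : BTree, if varEquiv t T Tstar then gwW γ α t T else 0) =
      ∑ R ∈ hfin.toFinset, gwW γ α t (toB t R) := by
    rw [← (toB_injective t).tsum_eq, tsum_eq_sum (s := hfin.toFinset)]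
    · exact Finset.sum_congr rfl fun R hR => if_pos ((hmem R).1 hR)
    · exact fun R hR => if_neg fun h => hR ((hmem R).2 h)
    · intro T hT
      exact exists_toB_eq (of_not_not fun h => hT (if_neg h))
  rw [hlim]
  refine (tendsto_finsetSum hfin.toFinset fun R _ => tendsto_expG_shape hα hγ t R).congr
    fun n => ?_
  rw [← expG_sum]
  congr 1
  funext g
  have he : (visitedV g t 0 none).Nodup ∧ (visitedF g t 0 none).Nodup ∧
      varEquiv t (exploreV g t 0 none) Tstar ↔
        (LForest.labels (2 * t) (Sum.inlₗ 0)
          (explore (adj g) (2 * t) (Sum.inlₗ 0) none)).Nodup ∧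
        LForest.shape (2 * t) (explore (adj g) (2 * t) (Sum.inlₗ 0) none) ∈ hfin.toFinset := by
    rw [← and_assoc, nodup_visited_iff, hmem, exploreV_eq]
    rfl
  rw [if_congr he rfl rfl]
  by_cases h : (LForest.labels (2 * t) (Sum.inlₗ 0)
      (explore (adj g) (2 * t) (Sum.inlₗ 0) none)).Nodup <;> simp [h]

end PaperObs
end

section
/- Let 𝖡(i,t) be the radius-t neighborhood of a fixed variable node i in a random bipartite graph G from the ensemble 𝒢(n, αn, γ/n), and let |𝖡(i,t)| denote its total number of variable and function nodes. Then for every λ > 0 there exists a finite constant C(λ, t), independent of n, such that for all n and all M ≥ 0: P{ |𝖡(i,t)| ≥ M } ≤ C(λ, t) · λ^{−M}. -/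
open Finset MeasureTheory Filter

namespace PaperObs

section Neighbors

variable {V F : Type*}

/-- The function nodes of `Y` adjacent to `S`. -/
def funNbrs (g : V → F → Bool) (S : Finset V) (Y : Finset F) : Finset F :=
  Y.filter fun a => ∃ j ∈ S, g j a = true

/-- The variable nodes of `X` adjacent to `T`. -/
def varNbrs (g : V → F → Bool) (T : Finset F) (X : Finset V) : Finset V :=
  X.filter fun j => ∃ a ∈ T, g j a = true

lemma funNbrs_congr {g g' : V → F → Bool} {S : Finset V} {Y : Finset F}
    (h : ∀ i ∈ S, ∀ a ∈ Y, g i a = g' i a) : funNbrs g S Y = funNbrs g' S Y :=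
  Finset.filter_congr fun a ha => exists_congr fun j => and_congr_right fun hj => by rw [h j hj a ha]

lemma varNbrs_congr {g g' : V → F → Bool} {T : Finset F} {X : Finset V}
    (h : ∀ i ∈ X, ∀ a ∈ T, g i a = g' i a) : varNbrs g T X = varNbrs g' T X :=
  Finset.filter_congr fun i hi => exists_congr fun a => and_congr_right fun ha => by rw [h i hi a ha]

lemma gW_nonneg [Fintype V] [Fintype F] {p : ℝ} (h0 : 0 ≤ p) (h1 : p ≤ 1) (g : V → F → Bool) : 0 ≤ gW p g :=
  Finset.prod_nonneg fun i _ => Finset.prod_nonneg fun a _ => by split_ifs <;> linarith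

end Neighbors

section Exploration

variable {V F : Type*} [Fintype V] [Fintype F] [DecidableEq V] [DecidableEq F]

lemma sum_graph_prod (v : V → F → Bool → ℝ) :
    ∑ g : V → F → Bool, ∏ i, ∏ a, v i a (g i a) = ∏ i, ∏ a, (v i a true + v i a false) := by
  have hrow (i : V) : ∏ a, (v i a true + v i a false) = ∑ r : F → Bool, ∏ a, v i a (r a) := by
    simp only [← Fintype.sum_bool]
    rw [Finset.prod_univ_sum, Fintype.piFinset_univ]
  simp only [hrow]
  rw [Finset.prod_univ_sum, Fintype.piFinset_univ]

lemma expG_prod (p : ℝ) (u : V → F → Bool → ℝ) :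
    expG p (fun g : V → F → Bool => ∏ i, ∏ a, u i a (g i a)) =
      ∏ i, ∏ a, (p * u i a true + (1 - p) * u i a false) := by
  simp only [expG, gW, ← Finset.prod_mul_distrib]
  rw [sum_graph_prod fun i a b => (if b then p else 1 - p) * u i a b]
  simp

lemma expG_const (p c : ℝ) : expG p (fun _ : V → F → Bool => c) = c := by
  have h := expG_prod (V := V) (F := F) p fun _ _ _ => 1
  simp only [Finset.prod_const_one, mul_one, add_sub_cancel] at h
  simp only [expG, mul_one] at h ⊢
  rw [← Finset.sum_mul, h, one_mul]

lemma expG_const_mul (p c : ℝ) (f : (V → F → Bool) → ℝ) :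
    expG p (fun g => c * f g) = c * expG p f := by
  simp only [expG, Finset.mul_sum]
  exact Finset.sum_congr rfl fun g _ => by ring

lemma expG_mono {p : ℝ} (h0 : 0 ≤ p) (h1 : p ≤ 1) {f h : (V → F → Bool) → ℝ}
    (hfh : ∀ g, f g ≤ h g) : expG p f ≤ expG p h :=
  Finset.sum_le_sum fun g _ => mul_le_mul_of_nonneg_left (hfh g) (gW_nonneg h0 h1 g)

lemma expG_le_of_abs_le_one (p : ℝ) {f : (V → F → Bool) → ℝ} (hf : ∀ g, |f g| ≤ 1) :
    expG p f ≤ (|p| + |1 - p|) ^ (Fintype.card V * Fintype.card F) := by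
  have h := sum_graph_prod (V := V) (F := F) fun _ _ b => |if b then p else 1 - p|
  simp only [Finset.prod_const, Finset.card_univ, ← pow_mul, if_true, Bool.false_eq_true,
    if_false] at h
  rw [mul_comm, ← h]
  refine Finset.sum_le_sum fun g _ => (le_abs_self _).trans ?_
  rw [abs_mul, gW]
  simp only [Finset.abs_prod]
  exact mul_le_of_le_one_right
    (Finset.prod_nonneg fun i _ => Finset.prod_nonneg fun a _ => abs_nonneg _) (hf g)

/-- The graph using the edges of `g` on `E` and the edges of `g'` off `E`. -/
def splice (E : V → F → Prop) [∀ i a, Decidable (E i a)] (g g' : V → F → Bool) : V → F → Bool :=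
  fun i a => if E i a then g i a else g' i a

/-- Functionals of disjoint sets of edges are independent. -/
lemma expG_decouple {τ : Type*} (p : ℝ) (E : V → F → Prop) [∀ i a, Decidable (E i a)]
    (T : (V → F → Bool) → τ) (Ψ : τ → (V → F → Bool) → ℝ)
    (hT : ∀ g g', (∀ i a, E i a → g i a = g' i a) → T g = T g')
    (hΨ : ∀ s g g', (∀ i a, ¬ E i a → g i a = g' i a) → Ψ s g = Ψ s g') :
    expG p (fun g => Ψ (T g) g) = expG p fun g => expG p fun g' => Ψ (T g) g' := by
  have key : ∑ q : (V → F → Bool) × (V → F → Bool), gW p q.1 * (gW p q.2 * Ψ (T q.1) q.2) =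
      ∑ q : (V → F → Bool) × (V → F → Bool), gW p q.2 * (gW p q.1 * Ψ (T q.1) q.1) := by
    have hinv : Function.Involutive fun q : (V → F → Bool) × (V → F → Bool) =>
        (splice E q.1 q.2, splice E q.2 q.1) := by
      rintro ⟨g, g'⟩
      ext i a <;> by_cases h : E i a <;> simp [splice, h]
    refine Fintype.sum_equiv hinv.toPerm _ _ ?_
    rintro ⟨g, g'⟩
    have hW : gW p (splice E g g') * gW p (splice E g' g) = gW p g * gW p g' := by
      simp only [gW, ← Finset.prod_mul_distrib]
      refine Finset.prod_congr rfl fun i _ => Finset.prod_congr rfl fun a _ => ?_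
      by_cases h : E i a <;> simp [splice, h, mul_comm]
    have h1 : T (splice E g g') = T g := hT _ _ fun i a h => by simp [splice, h]
    have h2 (s : τ) : Ψ s (splice E g g') = Ψ s g' := hΨ _ _ _ fun i a h => by simp [splice, h]
    simp only [Function.Involutive.coe_toPerm, h1, h2]
    rw [← mul_assoc, ← mul_assoc, ← hW]
    ring
  rw [Fintype.sum_prod_type, Fintype.sum_prod_type_right] at key
  simp only [expG, Finset.mul_sum]
  rw [key]
  simp only [← Finset.mul_sum]
  rw [← Finset.sum_mul]
  have h1 := expG_const (V := V) (F := F) p 1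
  simp only [expG, mul_one] at h1
  rw [h1, one_mul]

lemma one_add_mul_pow_le {p c κ : ℝ} (h0 : 0 ≤ p) (hc : 1 ≤ c) {N : ℕ} (hκ : p * N ≤ κ) :
    (p * c + (1 - p)) ^ N ≤ Real.exp (κ * c) := by
  have h : p * c + (1 - p) ≤ Real.exp (p * c) := by
    have := Real.add_one_le_exp (p * c)
    linarith
  have h' : 0 ≤ p * c + (1 - p) := by nlinarith
  calc (p * c + (1 - p)) ^ N ≤ Real.exp (p * c) ^ N := pow_le_pow_left₀ h' h N
    _ = Real.exp (p * N * c) := by rw [← Real.exp_nat_mul]; ring_nf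
    _ ≤ Real.exp (κ * c) := by gcongr

lemma expG_pow_card_funNbrs_le {p c κ : ℝ} (h0 : 0 ≤ p) (h1 : p ≤ 1) (hc : 1 ≤ c)
    (hκ : p * Fintype.card F ≤ κ) (S : Finset V) (Y : Finset F) :
    expG p (fun g => c ^ #(funNbrs g S Y)) ≤ Real.exp (κ * c) ^ #S := by
  have hpt (g : V → F → Bool) : c ^ #(funNbrs g S Y) ≤
      ∏ i, ∏ a, (if i ∈ S ∧ g i a = true then c else 1) := by
    have hsub : funNbrs g S Y ⊆ S.biUnion fun i => univ.filter fun a => g i a = true := by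
      intro a
      simp +contextual [funNbrs]
    calc c ^ #(funNbrs g S Y) ≤ c ^ ∑ i ∈ S, #(univ.filter fun a => g i a = true) :=
          pow_le_pow_right₀ hc ((card_le_card hsub).trans card_biUnion_le)
      _ = ∏ i, ∏ a, (if i ∈ S ∧ g i a = true then c else 1) := by
          rw [← Finset.prod_pow_eq_pow_sum, ← Finset.prod_subset (Finset.subset_univ S)]
          · refine Finset.prod_congr rfl fun i hi => ?_
            simp [hi, Finset.prod_ite]
          · intro i _ hi
            simp [hi]
  refine (expG_mono h0 h1 hpt).trans ?_
  rw [expG_prod p fun i _ b => if i ∈ S ∧ b = true then c else 1]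
  rw [← Finset.prod_subset (Finset.subset_univ S) fun i _ hi => by simp [hi]]
  calc ∏ i ∈ S, ∏ _a : F, (p * (if i ∈ S ∧ true = true then c else 1) +
        (1 - p) * (if i ∈ S ∧ false = true then c else 1))
      = ∏ _i ∈ S, (p * c + (1 - p)) ^ Fintype.card F :=
        Finset.prod_congr rfl fun i hi => by simp [hi]
    _ = ((p * c + (1 - p)) ^ Fintype.card F) ^ #S := by rw [Finset.prod_const]
    _ ≤ Real.exp (κ * c) ^ #S :=
        pow_le_pow_left₀ (pow_nonneg (by nlinarith) _) (one_add_mul_pow_le h0 hc hκ) _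

lemma expG_transpose (p : ℝ) (f : (F → V → Bool) → ℝ) :
    expG p (fun g : V → F → Bool => f fun a i => g i a) = expG p f := by
  refine Fintype.sum_equiv (Equiv.piComm fun (_ : V) (_ : F) => Bool) _ _ fun g => ?_
  simp only [gW]
  rw [Finset.prod_comm]
  rfl

lemma expG_pow_card_varNbrs_le {p c κ : ℝ} (h0 : 0 ≤ p) (h1 : p ≤ 1) (hc : 1 ≤ c)
    (hκ : p * Fintype.card V ≤ κ) (T : Finset F) (X : Finset V) :
    expG p (fun g => c ^ #(varNbrs g T X)) ≤ Real.exp (κ * c) ^ #T := by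
  have h := expG_transpose (V := V) p fun g : F → V → Bool => c ^ #(funNbrs g T X)
  exact h.le.trans (expG_pow_card_funNbrs_le h0 h1 hc hκ T X)

/-- The number of nodes found by `t` rounds of breadth-first exploration from the frontier `S`,
when `X` and `Y` are the variable and function nodes not yet discovered. -/
def explored (g : V → F → Bool) : ℕ → Finset V → Finset V → Finset F → ℕ
  | 0, S, _, _ => #S
  | t + 1, S, X, Y =>
    #S + #(funNbrs g S Y) + explored g t (varNbrs g (funNbrs g S Y) X)
      (X \ varNbrs g (funNbrs g S Y) X) (Y \ funNbrs g S Y)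

lemma explored_congr {g g' : V → F → Bool} (t : ℕ) (S X : Finset V) (Y : Finset F)
    (h : ∀ i ∈ S ∪ X, ∀ a ∈ Y, g i a = g' i a) : explored g t S X Y = explored g' t S X Y := by
  induction t generalizing S X Y with
  | zero => rfl
  | succ t ih =>
    have hT : funNbrs g S Y = funNbrs g' S Y :=
      funNbrs_congr fun i hi a ha => h i (mem_union_left _ hi) a ha
    have hTY : funNbrs g' S Y ⊆ Y := filter_subset _ _
    have hS : varNbrs g (funNbrs g' S Y) X = varNbrs g' (funNbrs g' S Y) X :=
      varNbrs_congr fun i hi a ha => h i (mem_union_right _ hi) a (hTY ha)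
    have hSX : varNbrs g' (funNbrs g' S Y) X ⊆ X := filter_subset _ _
    simp only [explored, hT, hS]
    rw [ih]
    intro i hi a ha
    rw [Finset.union_sdiff_of_subset hSX] at hi
    exact h i (mem_union_right _ hi) a (sdiff_subset ha)

/-- The growth rate of the exponential moments of `explored`. -/
noncomputable def expRate (κ L : ℝ) : ℕ → ℝ
  | 0 => L
  | t + 1 => L * Real.exp (κ * (L * Real.exp (κ * expRate κ L t)))

lemma one_le_expRate {κ L : ℝ} (hκ : 0 ≤ κ) (hL : 1 ≤ L) (t : ℕ) : 1 ≤ expRate κ L t := by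
  induction t with
  | zero => exact hL
  | succ t ih =>
    have : 0 ≤ κ * (L * Real.exp (κ * expRate κ L t)) := by positivity
    exact one_le_mul_of_one_le_of_one_le hL (Real.one_le_exp this)

lemma expG_pow_explored_le {p κ L : ℝ} (h0 : 0 ≤ p) (h1 : p ≤ 1) (hL : 1 ≤ L)
    (hV : p * Fintype.card V ≤ κ) (hF : p * Fintype.card F ≤ κ) (t : ℕ) (S X : Finset V)
    (Y : Finset F) (hSX : Disjoint S X) :
    expG p (fun g => L ^ explored g t S X Y) ≤ expRate κ L t ^ #S := by
  have hκ : 0 ≤ κ := le_trans (by positivity) hV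
  induction t generalizing S X Y with
  | zero => simp only [explored, expRate, expG_const, le_refl]
  | succ t ih =>
    set c := expRate κ L t with hc_def
    have hc : 1 ≤ c := one_le_expRate hκ hL t
    set d := L * Real.exp (κ * c) with hd_def
    have hd : 1 ≤ d := one_le_mul_of_one_le_of_one_le hL (Real.one_le_exp (by positivity))
    have hfrontier (T : Finset F) :
        expG p (fun g => L ^ explored g t (varNbrs g T X) (X \ varNbrs g T X) (Y \ T)) ≤
          Real.exp (κ * c) ^ #T := by
      have hsub (g : V → F → Bool) : varNbrs g T X ⊆ X := filter_subset _ _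
      have hdec := expG_decouple p (fun _ a => a ∈ T) (fun g => (varNbrs g T X))
        (fun s g => L ^ explored g t (s ∩ X) (X \ s) (Y \ T))
        (fun g g' h => varNbrs_congr fun i _ a ha => h i a ha)
        (fun s g g' h => by
          rw [explored_congr (g := g) (g' := g')]
          exact fun i _ a ha => h i a (Finset.mem_sdiff.1 ha).2)
      simp only [Finset.inter_eq_left.2 (hsub _)] at hdec
      rw [hdec]
      refine (expG_mono h0 h1 fun g => ih _ _ _ disjoint_sdiff).trans ?_
      exact expG_pow_card_varNbrs_le h0 h1 hc hV T X
    have hdec := expG_decouple p (fun i _ => i ∈ S) (fun g => (funNbrs g S Y))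
      (fun T g => L ^ (#S + #T + explored g t (varNbrs g T X) (X \ varNbrs g T X) (Y \ T)))
      (fun g g' h => funNbrs_congr fun i hi a _ => h i a hi)
      (fun T g g' h => by
        have hX : ∀ i ∈ X, ∀ a, g i a = g' i a := fun i hi a =>
          h i a fun hS => (Finset.disjoint_left.1 hSX) hS hi
        have hs : varNbrs g T X = varNbrs g' T X := varNbrs_congr fun i hi a _ => hX i hi a
        rw [hs, explored_congr (g := g) (g' := g')]
        intro i hi a _
        have hsub : varNbrs g' T X ⊆ X := filter_subset _ _
        rw [Finset.union_sdiff_of_subset hsub] at hi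
        exact hX i hi a)
    simp only [explored]
    rw [hdec]
    calc _ ≤ expG p (fun g : V → F → Bool => L ^ #S * d ^ #(funNbrs g S Y)) := by
          refine expG_mono h0 h1 fun g => ?_
          simp only [pow_add _ (_ + _) _, expG_const_mul]
          rw [pow_add, hd_def, mul_pow, ← mul_assoc]
          exact mul_le_mul_of_nonneg_left (hfrontier _) (by positivity)
      _ = L ^ #S * expG p (fun g : V → F → Bool => d ^ #(funNbrs g S Y)) := expG_const_mul _ _ _
      _ ≤ L ^ #S * Real.exp (κ * d) ^ #S :=
          mul_le_mul_of_nonneg_left (expG_pow_card_funNbrs_le h0 h1 hd hF S Y) (by positivity)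
      _ = expRate κ L (t + 1) ^ #S := by rw [← mul_pow]; rfl

/-- The variable nodes at distance at most one from `P`. -/
def varStep (g : V → F → Bool) (P : Finset V) : Finset V :=
  P ∪ varNbrs g (funNbrs g P univ) univ

/-- The function nodes met by walks of `t` steps from `P`. -/
def funReach (g : V → F → Bool) (P : Finset V) : ℕ → Finset F
  | 0 => ∅
  | t + 1 => funNbrs g ((varStep g)^[t] P) univ

lemma varBall_eq_iterate (g : V → F → Bool) (i : V) (t : ℕ) :
    varBall g i t = (varStep g)^[t] {i} := by
  induction t with
  | zero => rfl
  | succ t ih =>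
    rw [Function.iterate_succ_apply', ← ih, varBall, varStep]
    congr 1
    ext j
    simp only [varNbrs, funNbrs, mem_filter, mem_univ, true_and]
    exact exists_congr fun a => and_comm

lemma funBall_eq_funReach (g : V → F → Bool) (i : V) (t : ℕ) :
    funBall g i t = funReach g {i} t := by
  cases t with
  | zero => rfl
  | succ t => rw [funReach, ← varBall_eq_iterate]; rfl

lemma card_reach_le_explored (g : V → F → Bool) (t : ℕ) (S X : Finset V) (Y : Finset F)
    (hSX : Disjoint S X) (hX : ∀ i ∉ X, i ∉ S → ∀ a ∈ Y, g i a = false)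
    (hY : ∀ a ∉ Y, ∀ i ∈ X, g i a = false) :
    #((varStep g)^[t] Xᶜ ∩ X) + #(funReach g Xᶜ t ∩ Y) + #S ≤ explored g t S X Y := by
  induction t generalizing S X Y with
  | zero => simp [explored, funReach, ← disjoint_iff_inter_eq_empty, disjoint_compl_left]
  | succ t ih =>
    set T := funNbrs g S Y with hT
    set S' := varNbrs g T X with hS'
    have memT (a : F) : a ∈ T ↔ a ∈ Y ∧ ∃ j ∈ S, g j a = true := by simp [hT, funNbrs]
    have memS' (i : V) : i ∈ S' ↔ i ∈ X ∧ ∃ a ∈ T, g i a = true := by simp [hS', varNbrs]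
    have hTY : T ⊆ Y := filter_subset _ _
    have hSX' : S' ⊆ X := filter_subset _ _
    have hstep : varStep g Xᶜ = (X \ S')ᶜ := by
      ext i
      simp only [varStep, varNbrs, funNbrs, mem_union, mem_compl, mem_filter, mem_univ, true_and,
        Finset.mem_sdiff, memS']
      by_cases hi : i ∈ X
      · simp only [hi, not_true_eq_false, false_or, true_and, not_not]
        constructor
        · rintro ⟨a, ⟨j, hj, hja⟩, hia⟩
          have haY : a ∈ Y := by
            by_contra haY
            simp [hY a haY i hi] at hia
          have hjS : j ∈ S := by
            by_contra hjS
            simp [hX j hj hjS a haY] at hja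
          exact ⟨a, (memT a).2 ⟨haY, j, hjS, hja⟩, hia⟩
        · rintro ⟨a, haT, hia⟩
          obtain ⟨-, j, hjS, hja⟩ := (memT a).1 haT
          exact ⟨a, ⟨j, Finset.disjoint_left.1 hSX hjS, hja⟩, hia⟩
      · simp [hi]
    have hN : funNbrs g Xᶜ univ ∩ Y ⊆ T := by
      intro a
      simp only [funNbrs, mem_inter, mem_compl, mem_filter, mem_univ, true_and, memT]
      grind
    have hfun : funReach g Xᶜ (t + 1) ∩ Y ⊆ T ∪ (funReach g (X \ S')ᶜ t ∩ (Y \ T)) := by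
      cases t with
      | zero => exact hN.trans subset_union_left
      | succ t =>
        rw [funReach, Function.iterate_succ_apply, hstep, funReach]
        intro a
        simp only [mem_inter, mem_union, Finset.mem_sdiff]
        tauto
    have hvar : (varStep g)^[t + 1] Xᶜ ∩ X ⊆ S' ∪ ((varStep g)^[t] (X \ S')ᶜ ∩ (X \ S')) := by
      rw [Function.iterate_succ_apply, hstep]
      intro i
      simp only [mem_inter, mem_union, Finset.mem_sdiff]
      tauto
    have hrec := ih S' (X \ S') (Y \ T) disjoint_sdiff
      (fun i hi hi' a ha => by
        have := hX i
        simp only [Finset.mem_sdiff, memT] at hi ha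
        grind)
      (fun a ha i hi => by
        have := hY a
        simp only [Finset.mem_sdiff, memS'] at hi ha
        grind)
    have h1 := (card_le_card hfun).trans (card_union_le _ _)
    have h2 := (card_le_card hvar).trans (card_union_le _ _)
    rw [explored]
    simp only [← hT, ← hS']
    omega

lemma card_ball_le_explored (g : V → F → Bool) (i : V) (t : ℕ) :
    #(varBall g i t) + #(funBall g i t) ≤ explored g t {i} {i}ᶜ univ := by
  have h := card_reach_le_explored g t {i} {i}ᶜ univ disjoint_compl_right (by simp) (by simp)
  rw [compl_compl, ← varBall_eq_iterate, ← funBall_eq_funReach, inter_univ, card_singleton] at h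
  have h' := card_sdiff_add_card_inter (varBall g i t) {i}ᶜ
  have h'' : #(varBall g i t \ {i}ᶜ) ≤ 1 := by
    rw [sdiff_compl]
    exact (card_le_card inter_subset_right).trans (card_singleton i).le
  omega

lemma expG_ball_tail_le {p κ L : ℝ} (h0 : 0 ≤ p) (h1 : p ≤ 1) (hL : 1 ≤ L)
    (hV : p * Fintype.card V ≤ κ) (hF : p * Fintype.card F ≤ κ) (t M : ℕ) (i : V) :
    expG p (fun g : V → F → Bool =>
      if M ≤ #(varBall g i t) + #(funBall g i t) then 1 else 0) ≤ expRate κ L t / L ^ M := by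
  have hpos : 0 < L ^ M := by positivity
  rw [le_div_iff₀' hpos, ← expG_const_mul]
  have h := expG_pow_explored_le h0 h1 hL hV hF t {i} {i}ᶜ univ disjoint_compl_right
  rw [card_singleton, pow_one] at h
  refine le_trans (expG_mono h0 h1 fun g => ?_) h
  split_ifs with hM
  · rw [mul_one]
    exact pow_le_pow_right₀ hL (hM.trans (card_ball_le_explored g i t))
  · rw [mul_zero]
    positivity

end Exploration

/-- Proposition 4.2 of the paper: exponential tail bound for the size of
the radius-`t` neighbourhood.  Let `𝖡(i,t)` be the radius-`t` neighbourhood of a fixed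
variable node `i` in a random bipartite graph from the ensemble `𝒢(n, αn, γ/n)` and
`|𝖡(i,t)|` its total number of variable and function nodes.  For every `λ > 0` there is a
finite constant `C(λ,t)`, independent of `n`, such that for all `n`, all `m = αn` and all
`M ≥ 0`, `P{|𝖡(i,t)| ≥ M} ≤ C(λ,t) λ^{-M}`. -/
theorem statement_9 (α γ : ℝ) (hα : 0 < α) (hγ : 0 < γ) (t : ℕ) :
    ∀ lam : ℝ, 0 < lam → ∃ C : ℝ,
      ∀ (n m : ℕ), 0 < n → (m : ℝ) = α * n → ∀ (M : ℕ) (i : Fin n),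
        expG (γ / n)
            (fun g : Fin n → Fin m → Bool =>
              if M ≤ (varBall g i t).card + (funBall g i t).card then 1 else 0) ≤
          C / lam ^ M := by
  intro lam hlam
  set L := max lam 1 with hL_def
  have hL : 1 ≤ L := le_max_right _ _
  set κ := γ + α * γ with hκ_def
  have hR := one_le_expRate (κ := κ) (by positivity) hL t
  set A := ⌈γ⌉₊
  set B := ⌈α * γ⌉₊
  set K := (1 + 2 * γ) ^ (A * B) * L ^ (A + B) with hK_def
  have hK : 0 ≤ K := by positivity
  refine ⟨expRate κ L t + K, fun n m hn hm M i => ?_⟩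
  have hn' : (1 : ℝ) ≤ n := by exact_mod_cast hn
  have hp : 0 ≤ γ / n := by positivity
  have hlamL : lam ^ M ≤ L ^ M := pow_le_pow_left₀ hlam.le (le_max_left _ _) M
  rcases le_or_gt γ n with hγn | hγn
  · have h := expG_ball_tail_le (V := Fin n) (F := Fin m) (κ := κ) hp
      (div_le_one_of_le₀ hγn (by positivity)) hL
      (by rw [Fintype.card_fin, div_mul_cancel₀ _ (by positivity)]; nlinarith)
      (by rw [Fintype.card_fin, hm, hκ_def]; field_simp; nlinarith) t M i
    refine h.trans ?_
    gcongr
    linarith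
  · have hnA : n ≤ A := by exact_mod_cast hγn.le.trans (Nat.le_ceil γ)
    have hmB : m ≤ B := by
      have : (m : ℝ) ≤ B := by
        rw [hm]
        exact (mul_le_mul_of_nonneg_left hγn.le hα.le).trans (Nat.le_ceil _)
      exact_mod_cast this
    rcases le_or_gt M (n + m) with hM | hM
    · have hpγ : γ / n ≤ γ := div_le_self hγ.le hn'
      have habs : |γ / n| + |1 - γ / n| ≤ 1 + 2 * γ := by
        have := abs_sub (1 : ℝ) (γ / n)
        rw [abs_one, abs_of_nonneg hp] at this
        rw [abs_of_nonneg hp]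
        linarith
      have h := expG_le_of_abs_le_one (V := Fin n) (F := Fin m) (γ / n)
        (f := fun g => if M ≤ #(varBall g i t) + #(funBall g i t) then 1 else 0)
        (fun g => by split_ifs <;> simp)
      rw [Fintype.card_fin, Fintype.card_fin] at h
      rw [le_div_iff₀ (by positivity)]
      have h2 : (|γ / n| + |1 - γ / n|) ^ (n * m) ≤ (1 + 2 * γ) ^ (A * B) :=
        (pow_le_pow_left₀ (by positivity) habs _).trans
          (pow_le_pow_right₀ (by linarith) (Nat.mul_le_mul hnA hmB))
      have h3 : lam ^ M ≤ L ^ (A + B) := hlamL.trans (pow_le_pow_right₀ hL (by omega))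
      calc _ ≤ (1 + 2 * γ) ^ (A * B) * L ^ (A + B) :=
            mul_le_mul (h.trans h2) h3 (by positivity) (by positivity)
        _ ≤ expRate κ L t + K := by linarith
    · have hzero (g : Fin n → Fin m → Bool) :
          ¬ M ≤ #(varBall g i t) + #(funBall g i t) := by
        have h1 := card_le_univ (varBall g i t)
        have h2 := card_le_univ (funBall g i t)
        rw [Fintype.card_fin] at h1 h2
        omega
      simp only [hzero, if_false, expG_const]
      positivity

end PaperObs
end

section
/- Let X be a random variable taking values in a finite set 𝒳, and let G, Y₁, Y₂, B be random variables such that X → G → Y₁ → B and X → G → Y₂ → B are both Markov chains. Then E || P{X ∈ · | Y₁} − P{X ∈ · | Y₂} ||_TV ≤ 2 · E || P{X ∈ · | G} − P{X ∈ · | B} ||_TV. -/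
open MeasureTheory ProbabilityTheory Finset

namespace PaperObs

/-- If two `σ`-algebras `m₁`, `m₂` are conditionally independent given `m'`, then conditioning an
event of `m₁` on `m' ⊔ m₂` is the same as conditioning it on `m'`. -/
theorem condExp_sup_of_condIndep {Ω : Type*} {m' m₁ m₂ mΩ : MeasurableSpace Ω}
    [StandardBorelSpace Ω] {μ : Measure Ω} [IsFiniteMeasure μ] (hm' : m' ≤ mΩ) (hm₁ : m₁ ≤ mΩ)
    (hm₂ : m₂ ≤ mΩ) (h : CondIndep m' m₁ m₂ hm' μ) {A : Set Ω} (hA : MeasurableSet[m₁] A) :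
    μ⟦A | m' ⊔ m₂⟧ =ᵐ[μ] μ⟦A | m'⟧ := by
  have int_ind : ∀ {S : Set Ω}, MeasurableSet S → Integrable (S.indicator fun _ => (1 : ℝ)) μ :=
    fun hS => (integrable_const _).indicator hS
  have hA' := hm₁ _ hA
  have hle : m' ⊔ m₂ ≤ mΩ := sup_le hm' hm₂
  have hint : Integrable (μ⟦A | m'⟧) μ := integrable_condExp
  let π : Set (Set Ω) := {S | ∃ C D, MeasurableSet[m'] C ∧ MeasurableSet[m₂] D ∧ C ∩ D = S}
  have hπ : IsPiSystem π := by
    rintro _ ⟨C, D, hC, hD, rfl⟩ _ ⟨C', D', hC', hD', rfl⟩ -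
    exact ⟨C ∩ C', D ∩ D', hC.inter hC', hD.inter hD', Set.inter_inter_inter_comm _ _ _ _⟩
  have hgen : m' ⊔ m₂ = MeasurableSpace.generateFrom π := by
    refine le_antisymm (sup_le ?_ ?_) (MeasurableSpace.generateFrom_le ?_)
    · exact fun C hC => MeasurableSpace.measurableSet_generateFrom
        ⟨C, Set.univ, hC, MeasurableSet.univ, Set.inter_univ C⟩
    · exact fun D hD => MeasurableSpace.measurableSet_generateFrom
        ⟨Set.univ, D, MeasurableSet.univ, hD, Set.univ_inter D⟩
    · rintro _ ⟨C, D, hC, hD, rfl⟩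
      exact MeasurableSet.inter ((le_sup_left : m' ≤ m' ⊔ m₂) _ hC)
        ((le_sup_right : m₂ ≤ m' ⊔ m₂) _ hD)
  have basic : ∀ C D, MeasurableSet[m'] C → MeasurableSet[m₂] D →
      ∫ ω in C ∩ D, (μ⟦A | m'⟧) ω ∂μ = ∫ ω in C ∩ D, A.indicator (fun _ => (1 : ℝ)) ω ∂μ := by
    intro C D hC hD
    have hD' := hm₂ _ hD
    have hmul : (μ⟦A | m'⟧) * (D.indicator fun _ => (1 : ℝ)) = D.indicator (μ⟦A | m'⟧) := by
      ext ω
      by_cases hω : ω ∈ D <;> simp [hω]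
    have hpull : μ[D.indicator (μ⟦A | m'⟧) | m'] =ᵐ[μ] (μ⟦A | m'⟧) * (μ⟦D | m'⟧) := by
      rw [← hmul]
      exact condExp_mul_of_stronglyMeasurable_left stronglyMeasurable_condExp
        (hmul ▸ hint.indicator hD') (int_ind hD')
    have hind : μ⟦A ∩ D | m'⟧ =ᵐ[μ] (μ⟦A | m'⟧) * (μ⟦D | m'⟧) :=
      (condIndep_iff m' m₁ m₂ hm' hm₁ hm₂ μ).1 h A D hA hD
    calc ∫ ω in C ∩ D, (μ⟦A | m'⟧) ω ∂μ
        = ∫ ω in C, D.indicator (μ⟦A | m'⟧) ω ∂μ := (setIntegral_indicator hD').symm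
      _ = ∫ ω in C, (μ[D.indicator (μ⟦A | m'⟧) | m']) ω ∂μ :=
          (setIntegral_condExp hm' (hint.indicator hD') hC).symm
      _ = ∫ ω in C, (μ⟦A ∩ D | m'⟧) ω ∂μ :=
          integral_congr_ae (ae_restrict_of_ae (hpull.trans hind.symm))
      _ = ∫ ω in C, (A ∩ D).indicator (fun _ => (1 : ℝ)) ω ∂μ :=
          setIntegral_condExp hm' (int_ind (hA'.inter hD')) hC
      _ = ∫ ω in C ∩ D, A.indicator (fun _ => (1 : ℝ)) ω ∂μ := by
          rw [← setIntegral_indicator hD', Set.indicator_indicator, Set.inter_comm D A]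
  have all : ∀ S, MeasurableSet[m' ⊔ m₂] S →
      ∫ ω in S, (μ⟦A | m'⟧) ω ∂μ = ∫ ω in S, A.indicator (fun _ => (1 : ℝ)) ω ∂μ := by
    refine MeasurableSpace.induction_on_inter hgen hπ (by simp) ?_ ?_ ?_
    · rintro _ ⟨C, D, hC, hD, rfl⟩
      exact basic C D hC hD
    · intro S hS ih
      have huniv := basic Set.univ Set.univ MeasurableSet.univ MeasurableSet.univ
      simp only [Set.inter_univ, setIntegral_univ] at huniv
      rw [setIntegral_compl (hle _ hS) hint, setIntegral_compl (hle _ hS) (int_ind hA'), ih, huniv]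
    · intro S hdisj hS ih
      rw [integral_iUnion (fun i => hle _ (hS i)) hdisj hint.integrableOn,
        integral_iUnion (fun i => hle _ (hS i)) hdisj (int_ind hA').integrableOn]
      exact tsum_congr ih
  exact (ae_eq_condExp_of_forall_setIntegral_eq hle (int_ind hA') (fun _ _ _ => hint.integrableOn)
    (fun S hS _ => all S hS)
    (StronglyMeasurable.mono (m := m' ⊔ m₂) stronglyMeasurable_condExp
      le_sup_left).aestronglyMeasurable).symm

/-- If `mX → mG → mY → mB` is a Markov chain of `σ`-algebras, then the conditional probabilities of
an event of `mX` given `mY` and given `mB` are at least as close in `L¹` as those given `mG` and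
given `mB`. -/
theorem integral_abs_condExp_sub_le_of_condIndep {Ω : Type*} {mX mG mY mB mΩ : MeasurableSpace Ω}
    [StandardBorelSpace Ω] {μ : Measure Ω} [IsFiniteMeasure μ] (hmX : mX ≤ mΩ) (hmG : mG ≤ mΩ)
    (hmY : mY ≤ mΩ) (hmB : mB ≤ mΩ) (hXG : CondIndep mG mX (mY ⊔ mB) hmG μ)
    (hXY : CondIndep mY mX mB hmY μ) {A : Set Ω} (hA : MeasurableSet[mX] A) :
    ∫ ω, |(μ⟦A | mY⟧) ω - (μ⟦A | mB⟧) ω| ∂μ ≤ ∫ ω, |(μ⟦A | mG⟧) ω - (μ⟦A | mB⟧) ω| ∂μ := by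
  have hle : mY ⊔ mB ≤ mΩ := sup_le hmY hmB
  have hG : μ[μ⟦A | mG⟧ | mY ⊔ mB] =ᵐ[μ] μ⟦A | mY⟧ :=
    (condExp_congr_ae (condExp_sup_of_condIndep hmG hmX hle hXG hA).symm).trans
      ((condExp_condExp_of_le le_sup_right (sup_le hmG hle)).trans
        (condExp_sup_of_condIndep hmY hmX hmB hXY hA))
  have hB : μ[μ⟦A | mB⟧ | mY ⊔ mB] = μ⟦A | mB⟧ :=
    condExp_of_stronglyMeasurable hle (stronglyMeasurable_condExp.mono le_sup_right)
      integrable_condExp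
  have hsub : μ[μ⟦A | mG⟧ - μ⟦A | mB⟧ | mY ⊔ mB] =ᵐ[μ] μ⟦A | mY⟧ - μ⟦A | mB⟧ := by
    refine (condExp_sub integrable_condExp integrable_condExp _).trans ?_
    rw [hB]
    exact hG.sub Filter.EventuallyEq.rfl
  calc ∫ ω, |(μ⟦A | mY⟧) ω - (μ⟦A | mB⟧) ω| ∂μ
      = ∫ ω, |(μ[μ⟦A | mG⟧ - μ⟦A | mB⟧ | mY ⊔ mB]) ω| ∂μ := by
        refine integral_congr_ae ?_
        filter_upwards [hsub] with ω hω
        rw [hω, Pi.sub_apply]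
    _ ≤ _ := integral_abs_condExp_le _

/-- If `X → G → Y → B` is a Markov chain, then the conditional probabilities of an event of `X`
given `Y` and given `B` are at least as close in `L¹` as those given `G` and given `B`. -/
theorem integral_abs_condExp_sub_le_of_condIndepFun {Ω 𝒳 ΓG ΓY ΓB : Type*} [MeasurableSpace Ω]
    [StandardBorelSpace Ω] {μ : Measure Ω} [IsFiniteMeasure μ]
    [MeasurableSpace 𝒳] [MeasurableSpace ΓG] [MeasurableSpace ΓY] [MeasurableSpace ΓB]
    {X : Ω → 𝒳} {G : Ω → ΓG} {Y : Ω → ΓY} {B : Ω → ΓB}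
    (hX : Measurable X) (hG : Measurable G) (hY : Measurable Y) (hB : Measurable B)
    (hXG : CondIndepFun (MeasurableSpace.comap G inferInstance) hG.comap_le
      X (fun ω => (Y ω, B ω)) μ)
    (hXY : CondIndepFun (MeasurableSpace.comap Y inferInstance) hY.comap_le
      (fun ω => (X ω, G ω)) B μ)
    {s : Set 𝒳} (hs : MeasurableSet s) :
    ∫ ω, |(μ⟦X ⁻¹' s | MeasurableSpace.comap Y inferInstance⟧) ω -
        (μ⟦X ⁻¹' s | MeasurableSpace.comap B inferInstance⟧) ω| ∂μ ≤
      ∫ ω, |(μ⟦X ⁻¹' s | MeasurableSpace.comap G inferInstance⟧) ω -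
        (μ⟦X ⁻¹' s | MeasurableSpace.comap B inferInstance⟧) ω| ∂μ := by
  have hXG' := (condIndepFun_iff_condIndep _ hG.comap_le X _ μ).1 hXG
  have hcomap : MeasurableSpace.comap (fun ω => (Y ω, B ω)) Prod.instMeasurableSpace =
      MeasurableSpace.comap Y inferInstance ⊔ MeasurableSpace.comap B inferInstance :=
    MeasurableSpace.comap_prodMk Y B
  rw [hcomap] at hXG'
  exact integral_abs_condExp_sub_le_of_condIndep hX.comap_le hG.comap_le hY.comap_le hB.comap_le
    hXG' ((condIndepFun_iff_condIndep _ hY.comap_le X B μ).1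
      (hXY.comp measurable_fst measurable_id)) ⟨s, hs, rfl⟩

/-- Lemma 5.2 of the paper.  Let `X` be a random variable with values
in a finite set `𝒳`, and let `G, Y₁, Y₂, B` be random variables such that
`X → G → Y₁ → B` and `X → G → Y₂ → B` are Markov chains (encoded through the
conditional independence statements `X ⟂ (Y₁,B) | G`, `(X,G) ⟂ B | Y₁`, and the analogous
ones for `Y₂`).  Then
`E‖P{X ∈ · | Y₁} − P{X ∈ · | Y₂}‖_TV ≤ 2 E‖P{X ∈ · | G} − P{X ∈ · | B}‖_TV`. -/
theorem statement_11 {Ω : Type} [MeasurableSpace Ω] [StandardBorelSpace Ω] [Nonempty Ω]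
    (P : Measure Ω) [IsProbabilityMeasure P]
    {𝒳 ΓG Γ₁ Γ₂ ΓB : Type} [Fintype 𝒳] [MeasurableSpace 𝒳] [MeasurableSingletonClass 𝒳]
    [MeasurableSpace ΓG] [MeasurableSpace Γ₁] [MeasurableSpace Γ₂] [MeasurableSpace ΓB]
    (X : Ω → 𝒳) (G : Ω → ΓG) (Y₁ : Ω → Γ₁) (Y₂ : Ω → Γ₂) (B : Ω → ΓB)
    (hX : Measurable X) (hG : Measurable G) (hY₁ : Measurable Y₁)
    (hY₂ : Measurable Y₂) (hB : Measurable B)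
    (hchain₁ : CondIndepFun (MeasurableSpace.comap G inferInstance) hG.comap_le
      X (fun ω => (Y₁ ω, B ω)) P)
    (hchain₁' : CondIndepFun (MeasurableSpace.comap Y₁ inferInstance) hY₁.comap_le
      (fun ω => (X ω, G ω)) B P)
    (hchain₂ : CondIndepFun (MeasurableSpace.comap G inferInstance) hG.comap_le
      X (fun ω => (Y₂ ω, B ω)) P)
    (hchain₂' : CondIndepFun (MeasurableSpace.comap Y₂ inferInstance) hY₂.comap_le
      (fun ω => (X ω, G ω)) B P) :
    (∫ ω, 2⁻¹ * ∑ x : 𝒳,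
        |(P⟦X ⁻¹' {x} | MeasurableSpace.comap Y₁ inferInstance⟧) ω -
          (P⟦X ⁻¹' {x} | MeasurableSpace.comap Y₂ inferInstance⟧) ω| ∂P) ≤
      2 * ∫ ω, 2⁻¹ * ∑ x : 𝒳,
        |(P⟦X ⁻¹' {x} | MeasurableSpace.comap G inferInstance⟧) ω -
          (P⟦X ⁻¹' {x} | MeasurableSpace.comap B inferInstance⟧) ω| ∂P := by
  have habs : ∀ (x : 𝒳) (m m' : MeasurableSpace Ω),
      Integrable (fun ω => |(P⟦X ⁻¹' {x} | m⟧) ω - (P⟦X ⁻¹' {x} | m'⟧) ω|) P :=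
    fun x m m' => (integrable_condExp.sub integrable_condExp).abs
  rw [integral_const_mul, integral_const_mul, integral_finsetSum _ fun x _ => habs x _ _,
    integral_finsetSum _ fun x _ => habs x _ _, mul_left_comm]
  refine mul_le_mul_of_nonneg_left ?_ (by norm_num)
  rw [Finset.mul_sum]
  refine Finset.sum_le_sum fun x _ => ?_
  have h₁ := integral_abs_condExp_sub_le_of_condIndepFun hX hG hY₁ hB hchain₁ hchain₁'
    (measurableSet_singleton x)
  have h₂ := integral_abs_condExp_sub_le_of_condIndepFun hX hG hY₂ hB hchain₂ hchain₂'
    (measurableSet_singleton x)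
  have htri := integral_mono (habs x (MeasurableSpace.comap Y₁ inferInstance)
      (MeasurableSpace.comap Y₂ inferInstance))
    ((habs x (MeasurableSpace.comap Y₁ inferInstance) (MeasurableSpace.comap B inferInstance)).add
      (habs x (MeasurableSpace.comap Y₂ inferInstance) (MeasurableSpace.comap B inferInstance)))
    (fun ω => (abs_sub_le _ ((P⟦X ⁻¹' {x} | MeasurableSpace.comap B inferInstance⟧) ω) _).trans_eq
      (congrArg _ (abs_sub_comm _ _)))
  rw [integral_add' (habs x _ _) (habs x _ _)] at htri
  linarith

end PaperObs
end

section
/- Let p₁, p₂ be probability distributions on a finite set 𝒮, let 𝒮̂ be a finite set, and let q : 𝒮̂ × 𝒮 → ℝ₊ be a non-negative function with Σ_x q(x,y) > 0 for all y ∈ 𝒮. For a = 1, 2 define the probability distributions p̂_a(x) = Σ_{y∈𝒮} q(x,y) p_a(y) / Σ_{x'∈𝒮̂, y'∈𝒮} q(x',y') p_a(y'). Then || p̂₁ − p̂₂ ||_TV ≤ 2 · ( max_{y∈𝒮} Σ_x q(x,y) / min_{y∈𝒮} Σ_x q(x,y) ) · || p₁ − p₂ ||_TV. -/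
open Finset

namespace PaperObs

/-- Total variation distance between two functions on a finite set,
`‖q₁ − q₂‖_TV = (1/2) ∑_x |q₁(x) − q₂(x)|`. -/
noncomputable def tvDist {S : Type*} [Fintype S] (q₁ q₂ : S → ℝ) : ℝ :=
  2⁻¹ * ∑ x, |q₁ x - q₂ x|

/-- The normalized image of the distribution `p` under the nonnegative function `q`:
`p̂(x) = ∑_y q(x,y) p(y) / ∑_{x',y'} q(x',y') p(y')`. -/
noncomputable def pushNorm {S Shat : Type*} [Fintype S] [Fintype Shat]
    (q : Shat → S → ℝ) (p : S → ℝ) (x : Shat) : ℝ :=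
  (∑ y, q x y * p y) / ∑ x' : Shat, ∑ y' : S, q x' y' * p y'

/-- Normalizing two functions to total mass one increases their `ℓ¹` distance by at most a factor
of twice the inverse of the total mass of the first one. -/
theorem sum_abs_div_sum_sub_div_sum_le {X : Type*} [Fintype X] (f g : X → ℝ)
    (hg : ∀ x, 0 ≤ g x) (hF : 0 < ∑ x, f x) (hG : 0 < ∑ x, g x) :
    ∑ x, |f x / (∑ x', f x') - g x / (∑ x', g x')| ≤
      2 * (∑ x, |f x - g x|) / ∑ x, f x := by
  have hsub : |∑ x, g x - ∑ x, f x| ≤ ∑ x, |f x - g x| := by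
    rw [abs_sub_comm, ← Finset.sum_sub_distrib]
    exact Finset.abs_sum_le_sum_abs _ _
  set F := ∑ x, f x
  set G := ∑ x, g x with hGdef
  have hx : ∀ x, |f x / F - g x / G| ≤ |f x - g x| / F + g x / G * (|G - F| / F) := by
    intro x
    have h : f x / F - g x / G = (f x - g x) / F + g x / G * ((G - F) / F) := by
      field_simp
      ring
    rw [h]
    refine (abs_add_le _ _).trans_eq ?_
    rw [abs_mul, abs_div, abs_div (G - F), abs_of_pos hF,
      abs_of_nonneg (div_nonneg (hg x) hG.le)]
  calc ∑ x, |f x / F - g x / G|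
      ≤ ∑ x, (|f x - g x| / F + g x / G * (|G - F| / F)) := Finset.sum_le_sum fun x _ => hx x
    _ = (∑ x, |f x - g x|) / F + |G - F| / F := by
      rw [Finset.sum_add_distrib, ← Finset.sum_mul, ← Finset.sum_div, ← Finset.sum_div, ← hGdef,
        div_self hG.ne', one_mul]
    _ ≤ (∑ x, |f x - g x|) / F + (∑ x, |f x - g x|) / F := by gcongr
    _ = 2 * (∑ x, |f x - g x|) / F := by ring

/-- If all column sums of a nonnegative matrix are at most `M`, it expands the `ℓ¹` distance by a
factor of at most `M`. -/
theorem sum_abs_sum_mul_sub_le {X S : Type*} [Fintype X] [Fintype S] (q : X → S → ℝ)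
    (hq : ∀ x y, 0 ≤ q x y) {M : ℝ} (hM : ∀ y, ∑ x, q x y ≤ M) (p₁ p₂ : S → ℝ) :
    ∑ x, |(∑ y, q x y * p₁ y) - ∑ y, q x y * p₂ y| ≤ M * ∑ y, |p₁ y - p₂ y| := by
  calc ∑ x, |(∑ y, q x y * p₁ y) - ∑ y, q x y * p₂ y|
      ≤ ∑ x, ∑ y, q x y * |p₁ y - p₂ y| := by
        refine Finset.sum_le_sum fun x _ => ?_
        rw [← Finset.sum_sub_distrib]
        refine (Finset.abs_sum_le_sum_abs _ _).trans_eq (Finset.sum_congr rfl fun y _ => ?_)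
        rw [← mul_sub, abs_mul, abs_of_nonneg (hq x y)]
    _ = ∑ y, (∑ x, q x y) * |p₁ y - p₂ y| := by
        rw [Finset.sum_comm]
        simp only [Finset.sum_mul]
    _ ≤ ∑ y, M * |p₁ y - p₂ y| :=
        Finset.sum_le_sum fun y _ => mul_le_mul_of_nonneg_right (hM y) (abs_nonneg _)
    _ = M * ∑ y, |p₁ y - p₂ y| := (Finset.mul_sum _ _ _).symm

/-- If all column sums of a matrix are at least `m`, the image of a probability vector has total
mass at least `m`. -/
theorem le_sum_sum_mul {X S : Type*} [Fintype X] [Fintype S] (q : X → S → ℝ)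
    {m : ℝ} (hm : ∀ y, m ≤ ∑ x, q x y) (p : S → ℝ) (hp : ∀ y, 0 ≤ p y) (hp1 : ∑ y, p y = 1) :
    m ≤ ∑ x, ∑ y, q x y * p y := by
  calc m = ∑ y, m * p y := by rw [← Finset.mul_sum, hp1, mul_one]
    _ ≤ ∑ y, (∑ x, q x y) * p y :=
        Finset.sum_le_sum fun y _ => mul_le_mul_of_nonneg_right (hm y) (hp y)
    _ = ∑ x, ∑ y, q x y * p y := by
        rw [Finset.sum_comm]
        simp only [Finset.sum_mul]

/-- Lemma 5.1 of the paper.  Let `p₁, p₂` be probability distributions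
on a finite set `𝒮`, and `q : 𝒮̂ × 𝒮 → ℝ₊` nonnegative with `∑_x q(x,y) > 0` for all `y`.
Then the normalized images `p̂₁, p̂₂` satisfy
`‖p̂₁ − p̂₂‖_TV ≤ 2 (max_y ∑_x q(x,y) / min_y ∑_x q(x,y)) ‖p₁ − p₂‖_TV`. -/
theorem statement_16 {S Shat : Type} [Fintype S] [Nonempty S] [Fintype Shat]
    (p₁ p₂ : S → ℝ)
    (hp₁0 : ∀ y, 0 ≤ p₁ y) (hp₁1 : ∑ y, p₁ y = 1)
    (hp₂0 : ∀ y, 0 ≤ p₂ y) (hp₂1 : ∑ y, p₂ y = 1)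
    (q : Shat → S → ℝ) (hq : ∀ x y, 0 ≤ q x y)
    (hqpos : ∀ y, 0 < ∑ x : Shat, q x y) :
    tvDist (pushNorm q p₁) (pushNorm q p₂) ≤
      2 * ((Finset.univ.sup' Finset.univ_nonempty fun y => ∑ x : Shat, q x y) /
            (Finset.univ.inf' Finset.univ_nonempty fun y => ∑ x : Shat, q x y)) *
        tvDist p₁ p₂ := by
  set M := Finset.univ.sup' Finset.univ_nonempty fun y => ∑ x : Shat, q x y
  set m := Finset.univ.inf' Finset.univ_nonempty fun y => ∑ x : Shat, q x y
  have hM : ∀ y, ∑ x, q x y ≤ M := fun y =>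
    Finset.le_sup' (fun y => ∑ x : Shat, q x y) (Finset.mem_univ y)
  have hm : ∀ y, m ≤ ∑ x, q x y := fun y =>
    Finset.inf'_le (fun y => ∑ x : Shat, q x y) (Finset.mem_univ y)
  have hm0 : 0 < m := (Finset.lt_inf'_iff _).2 fun y _ => hqpos y
  have hZ₁ := le_sum_sum_mul q hm p₁ hp₁0 hp₁1
  have hZ₂ := le_sum_sum_mul q hm p₂ hp₂0 hp₂1
  have hnorm := sum_abs_div_sum_sub_div_sum_le (fun x => ∑ y, q x y * p₁ y)
    (fun x => ∑ y, q x y * p₂ y)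
    (fun x => Finset.sum_nonneg fun y _ => mul_nonneg (hq x y) (hp₂0 y))
    (hm0.trans_le hZ₁) (hm0.trans_le hZ₂)
  have hexp := sum_abs_sum_mul_sub_le q hq hM p₁ p₂
  unfold tvDist pushNorm
  calc _ ≤ 2⁻¹ * (2 * (∑ x, |(∑ y, q x y * p₁ y) - ∑ y, q x y * p₂ y|) /
          ∑ x, ∑ y, q x y * p₁ y) := mul_le_mul_of_nonneg_left hnorm (by norm_num)
    _ ≤ 2⁻¹ * (2 * (M * ∑ y, |p₁ y - p₂ y|) / m) := by
        have h0 : 0 ≤ M * ∑ y, |p₁ y - p₂ y| :=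
          (Finset.sum_nonneg fun x _ => abs_nonneg _).trans hexp
        gcongr
    _ = _ := by ring

end PaperObs
end
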